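/- Let μ ⊆ λ ⊆ (k^l) be partitions and set λ^{-1} = (k^l)/λ, the complement of λ in the k×l rectangle. Then for any partition α ⊆ (k^l), the Littlewood-Richardson coefficient c(λ; μ, α) equals c((k^l complement of α); μ, λ^{-1}), i.e. the coefficient of s_α in s_{λ/μ} equals the coefficient of s_{α^{-1}} in the (k^l)-truncated product Σ_{ν ⊆ (k^l)} c(ν; μ, λ^{-1}) s_ν, where α^{-1} = (k^l)/α. -/

import Mathlib

open YoungDiagram
open scoped Classical

namespace LRSkew

/-- The cells of the skew diagram `lam/mu`. -/
def skewCells (lam mu : YoungDiagram) : Finset (ℕ × ℕ) := lam.cells \ mu.cells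

/-- A semistandard filling of the skew shape `lam/mu`: entries are positive exactly on the
cells of the shape, rows are weakly increasing and columns are strictly increasing. -/
def IsSSYT (lam mu : YoungDiagram) (T : ℕ × ℕ → ℕ) : Prop :=
  (∀ p, p ∈ skewCells lam mu ↔ T p ≠ 0) ∧
  (∀ i j1 j2, (i, j1) ∈ skewCells lam mu → (i, j2) ∈ skewCells lam mu → j1 ≤ j2 →
    T (i, j1) ≤ T (i, j2)) ∧
  (∀ i1 i2 j, (i1, j) ∈ skewCells lam mu → (i2, j) ∈ skewCells lam mu → i1 < i2 →
    T (i1, j) < T (i2, j))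

/-- The number of entries equal to `k` among the cells read (in the reverse reading word:
right to left along rows, top row first) up to position `(i,j)`. -/
def prefixCount (lam mu : YoungDiagram) (T : ℕ × ℕ → ℕ) (i j k : ℕ) : ℕ :=
  ((skewCells lam mu).filter fun p => (p.1 < i ∨ (p.1 = i ∧ j ≤ p.2)) ∧ T p = k).card

/-- The reverse reading word of the filling is a lattice word. -/
def IsLattice (lam mu : YoungDiagram) (T : ℕ × ℕ → ℕ) : Prop :=
  ∀ i j k, prefixCount lam mu T i j (k + 2) ≤ prefixCount lam mu T i j (k + 1)

/-- The number of entries of the filling equal to `k`. -/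
def content (lam mu : YoungDiagram) (T : ℕ × ℕ → ℕ) (k : ℕ) : ℕ :=
  ((skewCells lam mu).filter fun p => T p = k).card

/-- A Littlewood–Richardson tableau of shape `lam/mu` and content `nu`. -/
def IsLR (lam mu nu : YoungDiagram) (T : ℕ × ℕ → ℕ) : Prop :=
  IsSSYT lam mu T ∧ IsLattice lam mu T ∧ ∀ i, content lam mu T (i + 1) = nu.rowLen i

/-- The Littlewood–Richardson coefficient `c(lam; mu, nu)`. -/
noncomputable def lrCoeff (lam mu nu : YoungDiagram) : ℕ :=
  if mu ≤ lam then {T : ℕ × ℕ → ℕ | IsLR lam mu nu T}.ncard else 0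

/-- Equality of the skew Schur functions `s_{lam/mu} = s_{alp/bet}`, expressed through
their expansions into Schur functions. -/
def SchurEq (lam mu alp bet : YoungDiagram) : Prop :=
  ∀ nu : YoungDiagram, lrCoeff lam mu nu = lrCoeff alp bet nu

/-- The rectangular Young diagram `(k^l)` with `l` rows of length `k`. -/
def rect (k l : ℕ) : YoungDiagram :=
  ⟨Finset.range l ×ˢ Finset.range k, by
    intro a b hba ha
    simp only [Finset.coe_product, Set.mem_prod, Finset.mem_coe, Finset.mem_range] at ha ⊢
    exact ⟨lt_of_le_of_lt hba.1 ha.1, lt_of_le_of_lt hba.2 ha.2⟩⟩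

/-- The complement of `nu` in the rectangle `(k^l)`, rotated by 180 degrees so that it is
again a partition: its parts are `(k - nu_l, …, k - nu_1)`. -/
def complRect (k l : ℕ) (nu : YoungDiagram) : YoungDiagram :=
  ⟨(rect k l).cells.filter fun p => (l - 1 - p.1, k - 1 - p.2) ∉ nu, by
    intro a b hba ha
    simp only [Finset.coe_filter, Set.mem_setOf_eq, mem_cells] at ha ⊢
    refine ⟨(rect k l).isLowerSet hba ha.1, fun hmem => ha.2 ?_⟩
    exact nu.isLowerSet
      (Prod.mk_le_mk.mpr ⟨Nat.sub_le_sub_left hba.1 _, Nat.sub_le_sub_left hba.2 _⟩) hmem⟩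

/-- The staircase partition `(n, n-1, …, 2, 1)`. -/
def staircase (n : ℕ) : YoungDiagram :=
  ⟨(Finset.range n ×ˢ Finset.range n).filter fun p => p.1 + p.2 < n, by
    intro a b hba ha
    simp only [Finset.coe_filter, Set.mem_setOf_eq, Finset.mem_product, Finset.mem_range] at ha ⊢
    exact ⟨⟨lt_of_le_of_lt hba.1 ha.1.1, lt_of_le_of_lt hba.2 ha.1.2⟩,
      lt_of_le_of_lt (Nat.add_le_add hba.1 hba.2) ha.2⟩⟩

/-- A basic skew diagram: no empty rows and no empty columns. -/
def IsBasic (lam mu : YoungDiagram) : Prop :=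
  (∀ i, i < lam.colLen 0 → mu.rowLen i < lam.rowLen i) ∧
  (∀ j, j < lam.rowLen 0 → mu.colLen j < lam.colLen j)

/-- A (basic) skew diagram is connected iff consecutive rows share a column. -/
def IsConnectedSkew (lam mu : YoungDiagram) : Prop :=
  ∀ i, i + 1 < lam.colLen 0 → mu.rowLen i < lam.rowLen (i + 1)

/-- The number of distinct (positive) part sizes of a partition. -/
def dp (lam : YoungDiagram) : ℕ :=
  ((Finset.range (lam.colLen 0)).image fun i => lam.rowLen i).card

/-- A partition is a rectangle: all its parts are equal. -/
def IsRect (mu : YoungDiagram) : Prop :=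
  ∀ i, i < mu.colLen 0 → mu.rowLen i = mu.rowLen 0

/-- Cells of a skew diagram in the same connected component: the reflexive–transitive
closure of sharing a row or a column. -/
def SameComp (s : Finset (ℕ × ℕ)) : ℕ × ℕ → ℕ × ℕ → Prop :=
  Relation.ReflTransGen fun a b => a ∈ s ∧ b ∈ s ∧ (a.1 = b.1 ∨ a.2 = b.2)

/-- Two finite sets of boxes agree up to translation or 180°-rotation of each connected
component independently. -/
def UpToTransRot (s t : Finset (ℕ × ℕ)) : Prop :=
  ∃ f : ℕ × ℕ → ℕ × ℕ, Set.BijOn f ↑s ↑t ∧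
    ∀ p ∈ s, ∀ q ∈ s, SameComp s p q →
      (((f q).1 : ℤ) - (f p).1 = (q.1 : ℤ) - p.1 ∧ ((f q).2 : ℤ) - (f p).2 = (q.2 : ℤ) - p.2) ∨
      (((f q).1 : ℤ) - (f p).1 = (p.1 : ℤ) - q.1 ∧ ((f q).2 : ℤ) - (f p).2 = (p.2 : ℤ) - q.2)


/-- A chain of horizontal strips from `mu` to `lam` with `l` steps. -/
def IsStripChain (l : ℕ) (mu lam : ℕ → ℕ) (C : ℕ → ℕ → ℕ) : Prop :=
  C 0 = mu ∧ (∀ j, l ≤ j → C j = lam) ∧ (∀ j i, C j i ≤ C (j + 1) i) ∧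
    ∀ j i, C (j + 1) (i + 1) ≤ C j i

/-- Violation of the lattice condition for the letters `j+1`, `j+2` in row `i`. -/
def Viol (C : ℕ → ℕ → ℕ) (j i : ℕ) : Prop :=
  ∑ r ∈ Finset.range (i + 1), C (j + 1) r + ∑ r ∈ Finset.range i, C (j + 1) r <
    ∑ r ∈ Finset.range (i + 1), C (j + 2) r + ∑ r ∈ Finset.range i, C j r

/-- Number of letters `j+1`. -/
def stepSize (l : ℕ) (C : ℕ → ℕ → ℕ) (j : ℕ) : ℕ :=
  ∑ r ∈ Finset.range l, C (j + 1) r - ∑ r ∈ Finset.range l, C j r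

/-- The excess at a violation. -/
def excess (C : ℕ → ℕ → ℕ) (k i : ℕ) : ℕ :=
  (∑ r ∈ Finset.range (i + 1), C (k + 2) r + ∑ r ∈ Finset.range i, C k r) -
    (∑ r ∈ Finset.range (i + 1), C (k + 1) r + ∑ r ∈ Finset.range i, C (k + 1) r)

/-- The new middle partition. -/
def flipRow (C : ℕ → ℕ → ℕ) (k i r : ℕ) : ℕ :=
  if r < i then C (k + 1) r
  else if r = i then max (C k i) (C (k + 2) (i + 1)) + excess C k i - 1
  else max (C k r) (C (k + 2) (r + 1)) + min (C (k + 2) r) (C k (r - 1)) - C (k + 1) r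

/-- The Bender-Knuth type involution. -/
def flipChain (C : ℕ → ℕ → ℕ) (k i : ℕ) : ℕ → ℕ → ℕ := Function.update C (k + 1) (flipRow C k i)

/-- `(i, k)` is the distinguished violation. -/
def FirstViol (C : ℕ → ℕ → ℕ) (k i : ℕ) : Prop :=
  Viol C k i ∧ (∀ i' < i, ∀ j, ¬ Viol C j i') ∧ ∀ j > k, ¬ Viol C j i

lemma FirstViol.unique {C : ℕ → ℕ → ℕ} {k i k' i' : ℕ} (h : FirstViol C k i)
    (h' : FirstViol C k' i') : k = k' ∧ i = i' := by
  have hi : i = i' := by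
    rcases lt_trichotomy i i' with hl | hl | hl
    · exact absurd h.1 (h'.2.1 i hl k)
    · exact hl
    · exact absurd h'.1 (h.2.1 i' hl k')
  subst hi
  refine ⟨?_, rfl⟩
  rcases lt_trichotomy k k' with hl | hl | hl
  · exact absurd h'.1 (h.2.2 k' hl)
  · exact hl
  · exact absurd h.1 (h'.2.2 k hl)

lemma viol_lt {l : ℕ} {mu lam : ℕ → ℕ} {C : ℕ → ℕ → ℕ} (hC : IsStripChain l mu lam C) {j i : ℕ}
    (h : Viol C j i) : j + 1 < l := by
  by_contra hl
  have h1 : C (j + 1) = lam := hC.2.1 _ (by omega)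
  have h2 : C (j + 2) = lam := hC.2.1 _ (by omega)
  have h3 : ∑ r ∈ Finset.range i, C j r ≤ ∑ r ∈ Finset.range i, C (j + 1) r :=
    Finset.sum_le_sum fun r _ => hC.2.2.1 j r
  unfold Viol at h
  rw [h2, ← h1] at h
  omega

lemma exists_firstViol {l : ℕ} {mu lam : ℕ → ℕ} {C : ℕ → ℕ → ℕ} (hC : IsStripChain l mu lam C)
    (h : ∃ j i, Viol C j i) : ∃ k i, FirstViol C k i := by
  have h' : ∃ i j, Viol C j i := by obtain ⟨j, i, h⟩ := h; exact ⟨i, j, h⟩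
  obtain ⟨j, hj⟩ := Nat.find_spec h'
  refine ⟨Nat.findGreatest (fun j => Viol C j (Nat.find h')) l, Nat.find h', ?_, ?_, ?_⟩
  · exact Nat.findGreatest_spec (P := fun j => Viol C j (Nat.find h')) (m := j)
      (by have := viol_lt hC hj; omega) hj
  · intro i' hi' j hv
    exact Nat.find_min h' hi' ⟨j, hv⟩
  · intro j hj hv
    exact Nat.findGreatest_is_greatest hj (by have := viol_lt hC hv; omega) hv

lemma flip_other {C : ℕ → ℕ → ℕ} {k i j : ℕ} (h : j ≠ k + 1) : flipChain C k i j = C j := by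
  simp [flipChain, Function.update_of_ne h]

lemma flip_same {C : ℕ → ℕ → ℕ} {k i : ℕ} : flipChain C k i (k + 1) = flipRow C k i := by
  simp [flipChain]

lemma flip_lt {C : ℕ → ℕ → ℕ} {k i j r : ℕ} (h : r < i) : flipChain C k i j r = C j r := by
  by_cases hj : j = k + 1
  · subst hj; simp [flip_same, flipRow, h]
  · rw [flip_other hj]

lemma excess_le {l : ℕ} {mu lam : ℕ → ℕ} {C : ℕ → ℕ → ℕ} (hC : IsStripChain l mu lam C) {k i : ℕ}
    (h : FirstViol C k i) : 1 ≤ excess C k i ∧ excess C k i + C (k + 1) i ≤ C (k + 2) i ∧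
      (0 < i → excess C k i + C (k + 1) i ≤ C k (i - 1)) := by
  have h1 := h.1
  unfold Viol at h1
  refine ⟨by unfold excess; omega, ?_⟩
  rcases i with _ | i
  · simp [excess] at h1 ⊢
    omega
  · have h2 := h.2.1 i (by omega) k
    unfold Viol at h2
    have a1 := hC.2.2.1 k i
    have a2 := hC.2.2.1 (k + 1) i
    have a3 := hC.2.2.2 (k + 1) i
    have a4 := hC.2.2.2 k i
    have a5 := hC.2.2.1 (k + 1) (i + 1)
    change C (k + 1) i ≤ C (k + 2) i at a2
    change C (k + 2) (i + 1) ≤ C (k + 1) i at a3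
    change C (k + 1) (i + 1) ≤ C (k + 2) (i + 1) at a5
    simp only [excess, Finset.sum_range_succ, Nat.add_sub_cancel] at *
    omega

lemma flipRow_bounds {l : ℕ} {mu lam : ℕ → ℕ} {C : ℕ → ℕ → ℕ} (hC : IsStripChain l mu lam C)
    {k i : ℕ} (h : FirstViol C k i) (r : ℕ) :
    C k r ≤ flipRow C k i r ∧ flipRow C k i r ≤ C (k + 2) r ∧ C (k + 2) (r + 1) ≤ flipRow C k i r ∧
      flipRow C k i (r + 1) ≤ C k r := by
  have key : ∀ r, C k r ≤ flipRow C k i r ∧ flipRow C k i r ≤ C (k + 2) r ∧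
      C (k + 2) (r + 1) ≤ flipRow C k i r ∧ (0 < r → flipRow C k i r ≤ C k (r - 1)) := by
    intro r
    have a1 := hC.2.2.1 k r
    have a2 := hC.2.2.1 (k + 1) r
    have a3 := hC.2.2.2 (k + 1) r
    have a4 : 0 < r → C (k + 1) r ≤ C k (r - 1) := by
      intro hr
      have := hC.2.2.2 k (r - 1)
      rwa [Nat.sub_add_cancel hr] at this
    simp only [add_assoc] at *
    norm_num at *
    unfold flipRow
    split_ifs with h1 h2
    · omega
    · subst h2
      have := excess_le hC h
      omega
    · omega
  refine ⟨(key r).1, (key r).2.1, (key r).2.2.1, ?_⟩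
  simpa using (key (r + 1)).2.2.2

lemma flip_chain {l : ℕ} {mu lam : ℕ → ℕ} {C : ℕ → ℕ → ℕ} (hC : IsStripChain l mu lam C)
    {k i : ℕ} (h : FirstViol C k i) : IsStripChain l mu lam (flipChain C k i) := by
  have hk := viol_lt hC h.1
  have hb := flipRow_bounds hC h
  refine ⟨?_, ?_, ?_, ?_⟩
  · rw [flip_other (by omega), hC.1]
  · intro j hj
    rw [flip_other (by omega), hC.2.1 j hj]
  · intro j r
    by_cases h1 : j = k
    · subst h1
      rw [flip_same, flip_other (by omega)]
      exact (hb r).1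
    · by_cases h2 : j = k + 1
      · subst h2
        rw [flip_same, flip_other (by omega)]
        exact (hb r).2.1
      · rw [flip_other h2, flip_other (by omega)]
        exact hC.2.2.1 j r
  · intro j r
    by_cases h1 : j = k
    · subst h1
      rw [flip_same, flip_other (by omega)]
      exact (hb r).2.2.2
    · by_cases h2 : j = k + 1
      · subst h2
        rw [flip_same, flip_other (by omega)]
        exact (hb r).2.2.1
      · rw [flip_other h2, flip_other (by omega)]
        exact hC.2.2.2 j r

lemma sum_flip_lt {C : ℕ → ℕ → ℕ} {k i j i' : ℕ} (h : i' ≤ i) :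
    ∑ r ∈ Finset.range i', flipChain C k i j r = ∑ r ∈ Finset.range i', C j r :=
  Finset.sum_congr rfl fun r hr => flip_lt (by have := Finset.mem_range.1 hr; omega)

lemma excess_flip {l : ℕ} {mu lam : ℕ → ℕ} {C : ℕ → ℕ → ℕ} (hC : IsStripChain l mu lam C)
    {k i : ℕ} (h : FirstViol C k i) :
    Viol (flipChain C k i) k i ∧ excess (flipChain C k i) k i + max (C k i) (C (k + 2) (i + 1)) =
      C (k + 1) i + 1 := by
  have h1 := h.1
  have h2 := excess_le hC h
  have a1 := hC.2.2.1 k i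
  have a3 := hC.2.2.2 (k + 1) i
  have e1 : flipRow C k i i = max (C k i) (C (k + 2) (i + 1)) + excess C k i - 1 := by
    simp [flipRow]
  unfold Viol excess at *
  rw [Finset.sum_range_succ, sum_flip_lt le_rfl, flip_same, e1, sum_flip_lt le_rfl,
    flip_other (j := k + 2) (by omega)]
  change C (k + 2) (i + 1) ≤ C (k + 1) i at a3
  simp only [Finset.sum_range_succ] at *
  omega

lemma flip_first {l : ℕ} {mu lam : ℕ → ℕ} {C : ℕ → ℕ → ℕ} (hC : IsStripChain l mu lam C)
    {k i : ℕ} (h : FirstViol C k i) : FirstViol (flipChain C k i) k i := by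
  refine ⟨(excess_flip hC h).1, ?_, ?_⟩
  · intro i' hi' j
    have := h.2.1 i' hi' j
    unfold Viol at this ⊢
    rwa [sum_flip_lt (by omega), sum_flip_lt (by omega), sum_flip_lt (by omega),
      sum_flip_lt (by omega)]
  · intro j hj
    have := h.2.2 j hj
    unfold Viol at this ⊢
    rwa [sum_flip_lt (i' := i) (by omega), sum_flip_lt (i' := i) (by omega),
      flip_other (j := j + 1) (by omega), flip_other (j := j + 2) (by omega)]

lemma flip_flip {l : ℕ} {mu lam : ℕ → ℕ} {C : ℕ → ℕ → ℕ} (hC : IsStripChain l mu lam C)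
    {k i : ℕ} (h : FirstViol C k i) : flipChain (flipChain C k i) k i = C := by
  funext j r
  by_cases hj : j = k + 1
  · subst hj
    rw [flip_same]
    have h2 := (excess_flip hC h).2
    rcases lt_trichotomy r i with hr | hr | hr
    · rw [flipRow, if_pos hr, flip_lt hr]
    · subst hr
      rw [flipRow, if_neg (by omega), if_pos rfl, flip_other (j := k) (by omega),
        flip_other (j := k + 2) (by omega)]
      omega
    · rw [flipRow, if_neg (by omega), if_neg (by omega), flip_other (j := k) (by omega),
        flip_other (j := k + 2) (by omega), flip_same, flipRow, if_neg (by omega),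
        if_neg (by omega)]
      have a1 := hC.2.2.1 k r
      have a2 := hC.2.2.1 (k + 1) r
      have a3 := hC.2.2.2 (k + 1) r
      have a4 : C (k + 1) r ≤ C k (r - 1) := by
        have := hC.2.2.2 k (r - 1)
        rwa [Nat.sub_add_cancel (by omega)] at this
      simp only [add_assoc] at *
      norm_num at *
      omega
  · rw [flip_other hj, flip_other hj]

lemma chain_zero {l : ℕ} {mu lam : ℕ → ℕ} {C : ℕ → ℕ → ℕ} (hC : IsStripChain l mu lam C)
    (hl : ∀ i, l ≤ i → lam i = 0) (j i : ℕ) (hi : l ≤ i) : C j i = 0 := by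
  have hm : Monotone fun j => C j i := monotone_nat_of_le_succ fun j => hC.2.2.1 j i
  have h1 : C j i ≤ C (max j l) i := hm (le_max_left _ _)
  rw [hC.2.1 _ (le_max_right _ _), hl i hi] at h1
  omega

lemma sum_flip {l : ℕ} {mu lam : ℕ → ℕ} {C : ℕ → ℕ → ℕ} (hC : IsStripChain l mu lam C)
    (hl : ∀ i, l ≤ i → lam i = 0)
    {k i : ℕ} (h : FirstViol C k i) :
    ∑ r ∈ Finset.range l, C (k + 1) r + ∑ r ∈ Finset.range l, flipRow C k i r + 1 =
      ∑ r ∈ Finset.range l, C k r + ∑ r ∈ Finset.range l, C (k + 2) r := by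
  have aux : ∀ n, ∑ r ∈ Finset.range (i + 1 + n), C (k + 1) r +
      ∑ r ∈ Finset.range (i + 1 + n), flipRow C k i r + 1 + C k (i + n) =
      ∑ r ∈ Finset.range (i + 1 + n), C k r + ∑ r ∈ Finset.range (i + 1 + n), C (k + 2) r +
        max (C k (i + n)) (C (k + 2) (i + n + 1)) := by
    intro n
    induction n with
    | zero =>
      have h1 := h.1
      have h2 := excess_le hC h
      have e1 : flipRow C k i i = max (C k i) (C (k + 2) (i + 1)) + excess C k i - 1 := by
        simp [flipRow]
      have e2 : ∑ r ∈ Finset.range i, flipRow C k i r = ∑ r ∈ Finset.range i, C (k + 1) r :=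
        Finset.sum_congr rfl fun r hr => by simp [flipRow, Finset.mem_range.1 hr]
      unfold Viol excess at *
      simp only [Finset.sum_range_succ, add_zero, e1, e2] at *
      omega
    | succ n ih =>
      have a1 := hC.2.2.1 k (i + n + 1)
      have a2 := hC.2.2.1 (k + 1) (i + n + 1)
      have a3 := hC.2.2.2 (k + 1) (i + n + 1)
      have a4 := hC.2.2.2 k (i + n)
      have e1 : flipRow C k i (i + n + 1) = max (C k (i + n + 1)) (C (k + 2) (i + n + 1 + 1)) +
          min (C (k + 2) (i + n + 1)) (C k (i + n)) - C (k + 1) (i + n + 1) := by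
        rw [flipRow, if_neg (by omega), if_neg (by omega)]; rfl
      have e3 : i + 1 + (n + 1) = (i + 1 + n) + 1 := by omega
      have e4 : i + 1 + n = i + n + 1 := by omega
      have e5 : i + (n + 1) = i + n + 1 := by omega
      rw [e3, e5]
      simp only [Finset.sum_range_succ _ (i + 1 + n)]
      rw [e4] at ih ⊢
      rw [e1]
      change C (k + 1) (i + n + 1) ≤ C (k + 2) (i + n + 1) at a2
      change C (k + 2) (i + n + 1 + 1) ≤ C (k + 1) (i + n + 1) at a3
      omega
  have hz : ∀ j r, l ≤ r → C j r = 0 := fun j r hr => chain_zero hC hl j r hr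
  have hz' : ∀ r, l ≤ r → flipRow C k i r = 0 := fun r hr => by
    have := (flipRow_bounds hC h r).2.1
    rw [hz _ _ hr] at this; omega
  have hext : ∀ f : ℕ → ℕ, (∀ r, l ≤ r → f r = 0) →
      ∑ r ∈ Finset.range (i + 1 + l), f r = ∑ r ∈ Finset.range l, f r := by
    intro f hf
    symm
    apply Finset.sum_subset
    · intro x; simp only [Finset.mem_range]; omega
    · intro x _ hx
      exact hf x (by simpa using hx)
  have := aux l
  rw [hext _ (hz _), hext _ (hz _), hext _ (hz _), hext _ hz', hz _ _ (by omega),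
    hz _ _ (by omega)] at this
  omega

lemma sum_mono_chain {l : ℕ} {mu lam : ℕ → ℕ} {C : ℕ → ℕ → ℕ} (hC : IsStripChain l mu lam C)
    (n j : ℕ) : ∑ r ∈ Finset.range n, C j r ≤ ∑ r ∈ Finset.range n, C (j + 1) r :=
  Finset.sum_le_sum fun r _ => hC.2.2.1 j r

lemma size_flip {l : ℕ} {mu lam : ℕ → ℕ} {C : ℕ → ℕ → ℕ} (hC : IsStripChain l mu lam C)
    (hl : ∀ i, l ≤ i → lam i = 0)
    {k i : ℕ} (h : FirstViol C k i) :
    stepSize l (flipChain C k i) k + 1 = stepSize l C (k + 1) ∧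
    stepSize l (flipChain C k i) (k + 1) = stepSize l C k + 1 ∧
    ∀ j, j ≠ k → j ≠ k + 1 → stepSize l (flipChain C k i) j = stepSize l C j := by
  have h1 := sum_flip hC hl h
  have b1 := sum_mono_chain hC l k
  have b2 := sum_mono_chain hC l (k + 1)
  have b3 := sum_mono_chain (flip_chain hC h) l k
  have b4 := sum_mono_chain (flip_chain hC h) l (k + 1)
  rw [flip_same, flip_other (by omega)] at b3 b4
  refine ⟨?_, ?_, ?_⟩
  · unfold stepSize
    rw [flip_same, flip_other (by omega)]
    change _ = ∑ r ∈ Finset.range l, C (k + 2) r - _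
    change _ ≤ ∑ r ∈ Finset.range l, C (k + 2) r at b2
    change _ ≤ ∑ r ∈ Finset.range l, C (k + 2) r at b4
    omega
  · unfold stepSize
    rw [flip_same, flip_other (by omega)]
    change ∑ r ∈ Finset.range l, C (k + 2) r - _ = _
    change _ ≤ ∑ r ∈ Finset.range l, C (k + 2) r at b2
    change _ ≤ ∑ r ∈ Finset.range l, C (k + 2) r at b4
    omega
  · intro j h1 h2
    unfold stepSize
    rw [flip_other h2, flip_other (by omega)]

lemma finite_chains (l : ℕ) (mu lam : ℕ → ℕ) (hl : ∀ i, l ≤ i → lam i = 0) :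
    {C | IsStripChain l mu lam C}.Finite := by
  apply Set.Finite.of_injOn (f := fun C => fun (j i : Fin l) => C j i)
    (t := Set.Iic (fun _ i => lam i))
  · intro C hC j i
    have hm : Monotone fun j => C j i := monotone_nat_of_le_succ fun j => hC.2.2.1 j i
    have h1 : C j i ≤ C l i := hm j.2.le
    rwa [hC.2.1 l le_rfl] at h1
  · intro C hC D hD h
    funext j i
    by_cases hj : l ≤ j
    · rw [hC.2.1 j hj, hD.2.1 j hj]
    by_cases hi : l ≤ i
    · rw [chain_zero hC hl j i hi, chain_zero hD hl j i hi]
    exact congrFun (congrFun h ⟨j, by omega⟩) ⟨i, by omega⟩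
  · exact Set.finite_Iic _

/-- Finset of chains. -/
noncomputable def chainSet (l : ℕ) (mu lam : ℕ → ℕ) (hl : ∀ i, l ≤ i → lam i = 0) :
    Finset (ℕ → ℕ → ℕ) := (finite_chains l mu lam hl).toFinset

lemma mem_chainSet {l : ℕ} {mu lam : ℕ → ℕ} {hl : ∀ i, l ≤ i → lam i = 0} {C : ℕ → ℕ → ℕ} :
    C ∈ chainSet l mu lam hl ↔ IsStripChain l mu lam C := by simp [chainSet]

/-- Lattice chains. -/
def LatticeChain (C : ℕ → ℕ → ℕ) : Prop := ∀ j i, ¬ Viol C j i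

/-- antisymmetry with respect to shifted adjacent swaps -/
def Alternates (l : ℕ) (g : (ℕ → ℕ) → ℤ) : Prop :=
  ∀ k, k + 1 < l → ∀ b b' : ℕ → ℕ, b' k + 1 = b (k + 1) → b' (k + 1) = b k + 1 →
    (∀ j, j ≠ k → j ≠ k + 1 → b' j = b j) → g b' = - g b

theorem sum_chains_eq (l : ℕ) (mu lam : ℕ → ℕ) (hl : ∀ i, l ≤ i → lam i = 0)
    (g : (ℕ → ℕ) → ℤ) (hg : Alternates l g) :
    ∑ C ∈ chainSet l mu lam hl, g (stepSize l C) =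
      ∑ C ∈ (chainSet l mu lam hl).filter LatticeChain, g (stepSize l C) := by
  rw [← Finset.sum_filter_add_sum_filter_not _ LatticeChain, add_eq_left]
  have hex : ∀ C ∈ (chainSet l mu lam hl).filter (fun C => ¬ LatticeChain C),
      ∃ p : ℕ × ℕ, FirstViol C p.1 p.2 := by
    intro C hC
    rw [Finset.mem_filter, mem_chainSet] at hC
    obtain ⟨hC, hv⟩ := hC
    simp only [LatticeChain, not_forall, not_not] at hv
    obtain ⟨k, i, h⟩ := exists_firstViol hC hv
    exact ⟨(k, i), h⟩
  choose! p hp using hex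
  have hm : ∀ C ∈ (chainSet l mu lam hl).filter (fun C => ¬ LatticeChain C),
      IsStripChain l mu lam C := fun C hC => mem_chainSet.1 (Finset.mem_filter.1 hC).1
  have hmem : ∀ C ∈ (chainSet l mu lam hl).filter (fun C => ¬ LatticeChain C),
      flipChain C (p C).1 (p C).2 ∈ (chainSet l mu lam hl).filter (fun C => ¬ LatticeChain C) := by
    intro C hC
    rw [Finset.mem_filter, mem_chainSet]
    refine ⟨flip_chain (hm C hC) (hp C hC), fun hL => ?_⟩
    exact hL _ _ (flip_first (hm C hC) (hp C hC)).1
  have hanti : ∀ C ∈ (chainSet l mu lam hl).filter (fun C => ¬ LatticeChain C),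
      g (stepSize l (flipChain C (p C).1 (p C).2)) = - g (stepSize l C) := by
    intro C hC
    obtain ⟨h1, h2, h3⟩ := size_flip (hm C hC) hl (hp C hC)
    exact hg _ (viol_lt (hm C hC) (hp C hC).1) _ _ h1 h2 h3
  refine Finset.sum_involution (fun C _ => flipChain C (p C).1 (p C).2) ?_ ?_ hmem ?_
  · intro C hC
    rw [hanti C hC]; ring
  · intro C hC hne heq
    have := hanti C hC
    rw [heq] at this
    omega
  · intro C hC
    have h1 := flip_first (hm C hC) (hp C hC)
    have h2 := hp _ (hmem C hC)
    obtain ⟨e1, e2⟩ := h2.unique h1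
    simp only [e1, e2]
    exact flip_flip (hm C hC) (hp C hC)

open MvPolynomial in
/-- The alternant with exponents `v + δ`. -/
noncomputable def alt (l : ℕ) (v : ℕ → ℕ) : MvPolynomial (Fin l) ℤ :=
  (Matrix.of fun i j : Fin l => (X i : MvPolynomial (Fin l) ℤ) ^ (v j + (l - 1 - j))).det

open MvPolynomial in
/-- Complete homogeneous symmetric polynomial. -/
noncomputable def hPoly (l r : ℕ) : MvPolynomial (Fin l) ℤ :=
  ∑ γ ∈ Finset.piAntidiag (Finset.univ : Finset (Fin l)) r, ∏ i : Fin l, X i ^ γ i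

lemma alt_congr {l : ℕ} {v v' : ℕ → ℕ} (h : ∀ i < l, v i = v' i) : alt l v = alt l v' := by
  unfold alt
  congr 1
  ext1 i j
  simp [h j j.2]

lemma alt_swap {l k : ℕ} (hk : k + 1 < l) {b b' : ℕ → ℕ} (h1 : b' k + 1 = b (k + 1))
    (h2 : b' (k + 1) = b k + 1) (h3 : ∀ j, j ≠ k → j ≠ k + 1 → b' j = b j) :
    alt l b' = - alt l b := by
  unfold alt
  set a : Fin l := ⟨k, by omega⟩
  set c : Fin l := ⟨k + 1, hk⟩
  have hac : a ≠ c := by simp [a, c]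
  have := Matrix.det_permute' (Equiv.swap a c) (Matrix.of fun i j : Fin l =>
    (MvPolynomial.X i : MvPolynomial (Fin l) ℤ) ^ (b j + (l - 1 - j)))
  rw [Equiv.Perm.sign_swap hac] at this
  simp only [Units.val_neg, Units.val_one, Int.cast_neg, Int.cast_one, neg_mul, one_mul] at this
  rw [← this]
  congr 1
  ext1 i j
  simp only [Matrix.of_apply, Matrix.submatrix_apply, id_eq]
  congr 1
  by_cases hja : j = a
  · subst hja
    rw [Equiv.swap_apply_left]
    simp only [a, c]
    omega
  by_cases hjc : j = c
  · subst hjc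
    rw [Equiv.swap_apply_right]
    simp only [a, c]
    omega
  rw [Equiv.swap_apply_of_ne_of_ne hja hjc, h3]
  · intro h; exact hja (Fin.ext h)
  · intro h; exact hjc (Fin.ext h)

lemma rename_hPoly (l r : ℕ) (σ : Equiv.Perm (Fin l)) :
    MvPolynomial.rename σ (hPoly l r) = hPoly l r := by
  unfold hPoly
  simp only [map_sum, map_prod, map_pow, MvPolynomial.rename_X]
  refine Finset.sum_nbij' (fun γ => γ ∘ σ.symm) (fun γ => γ ∘ σ) ?_ ?_ ?_ ?_ ?_
  · intro γ h
    simp only [Finset.mem_piAntidiag, Finset.mem_univ, implies_true, and_true] at h ⊢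
    rw [← h]
    exact Equiv.sum_comp σ.symm γ
  · intro γ h
    simp only [Finset.mem_piAntidiag, Finset.mem_univ, implies_true, and_true] at h ⊢
    rw [← h]
    exact Equiv.sum_comp σ γ
  · intro γ _; ext; simp
  · intro γ _; ext; simp
  · intro γ _
    rw [← Equiv.prod_comp σ.symm]
    simp

lemma rename_alt (l : ℕ) (v : ℕ → ℕ) (σ : Equiv.Perm (Fin l)) :
    MvPolynomial.rename σ (alt l v) = ((Equiv.Perm.sign σ : ℤ) : MvPolynomial (Fin l) ℤ) * alt l v := by
  unfold alt
  rw [AlgHom.map_det, ← Matrix.det_permute]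
  congr 1
  ext1 i j
  simp

lemma alt_mul_hPoly (l : ℕ) (v : ℕ → ℕ) (r : ℕ) :
    alt l v * hPoly l r = ∑ γ ∈ Finset.piAntidiag (Finset.range l) r, alt l (v + γ) := by
  have h1 : alt l v * hPoly l r = ∑ γ ∈ Finset.piAntidiag (Finset.univ : Finset (Fin l)) r,
      alt l (fun i => v i + if h : i < l then γ ⟨i, h⟩ else 0) := by
    unfold alt
    simp only [Matrix.det_apply']
    rw [Finset.sum_comm, Finset.sum_mul]
    refine Finset.sum_congr rfl fun σ _ => ?_
    rw [← rename_hPoly l r σ]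
    unfold hPoly
    simp only [map_sum, map_prod, map_pow, MvPolynomial.rename_X]
    rw [Finset.mul_sum]
    refine Finset.sum_congr rfl fun γ _ => ?_
    rw [mul_assoc, ← Finset.prod_mul_distrib]
    congr 1
    refine Finset.prod_congr rfl fun i _ => ?_
    simp only [Matrix.of_apply, Fin.is_lt, dif_pos, Fin.eta]
    ring
  rw [h1]
  refine Finset.sum_nbij' (fun γ i => if h : i < l then γ ⟨i, h⟩ else 0) (fun γ i => γ i)
    ?_ ?_ ?_ ?_ ?_
  · intro γ h
    simp only [Finset.mem_piAntidiag, Finset.mem_univ, implies_true, and_true] at h ⊢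
    refine ⟨?_, ?_⟩
    · rw [← h, Finset.sum_range]
      simp
    · intro i hi
      by_contra hc
      simp only [Finset.mem_range] at hc
      simp [hc] at hi
  · intro γ h
    simp only [Finset.mem_piAntidiag, Finset.mem_univ, implies_true, and_true] at h ⊢
    rw [← h.1, Finset.sum_range]
  · intro γ _; ext i; simp
  · intro γ h
    simp only [Finset.mem_piAntidiag] at h
    ext i
    by_cases hi : i < l
    · simp [hi]
    · simp only [hi, dif_neg, not_false_eq_true]
      by_contra hc
      exact hi (Finset.mem_range.1 (h.2 i (Ne.symm hc)))
  · intro γ _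
    rfl

/-- Increments giving a horizontal strip of size `r`. -/
noncomputable def stripSet (l : ℕ) (κ : ℕ → ℕ) (r : ℕ) : Finset (ℕ → ℕ) :=
  (Finset.piAntidiag (Finset.range l) r).filter fun γ => ∀ i, κ (i + 1) + γ (i + 1) ≤ κ i

/-- The sign-reversing involution for the Pieri rule. -/
def pieriFlip (κ γ : ℕ → ℕ) (i : ℕ) : ℕ → ℕ := fun j =>
  if j = i then κ (i + 1) + γ (i + 1) - 1 - κ i
  else if j = i + 1 then κ i + γ i + 1 - κ (i + 1) else γ j

lemma pieri (l : ℕ) (κ : ℕ → ℕ) (hκ : Antitone κ) (hz : ∀ i, l ≤ i → κ i = 0) (r : ℕ) :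
    alt l κ * hPoly l r = ∑ γ ∈ stripSet l κ r, alt l (κ + γ) := by
  rw [alt_mul_hPoly, stripSet, ← Finset.sum_filter_add_sum_filter_not _
    (fun γ : ℕ → ℕ => ∀ i, κ (i + 1) + γ (i + 1) ≤ κ i), add_eq_left]
  have hzero : ∀ γ ∈ Finset.piAntidiag (Finset.range l) r, ∀ i, l ≤ i → γ i = 0 := by
    intro γ h i hi
    simp only [Finset.mem_piAntidiag] at h
    by_contra hc
    have := h.2 i hc
    simp at this; omega
  have hlt : ∀ γ ∈ Finset.piAntidiag (Finset.range l) r, ∀ i, κ i < κ (i + 1) + γ (i + 1) →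
      i + 1 < l := by
    intro γ h i hi
    by_contra hc
    rw [hz (i + 1) (by omega), hzero γ h (i + 1) (by omega)] at hi
    omega
  set B := (Finset.piAntidiag (Finset.range l) r).filter
    (fun γ : ℕ → ℕ => ¬ ∀ i, κ (i + 1) + γ (i + 1) ≤ κ i) with hB
  have hex : ∀ γ ∈ B, ∃ i, κ i < κ (i + 1) + γ (i + 1) ∧ ∀ i' > i, κ (i' + 1) + γ (i' + 1) ≤ κ i' := by
    intro γ h
    rw [hB, Finset.mem_filter] at h
    obtain ⟨hm, hb⟩ := h
    push Not at hb
    obtain ⟨j, hj⟩ := hb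
    refine ⟨Nat.findGreatest (fun i => κ i < κ (i + 1) + γ (i + 1)) l, ?_, ?_⟩
    · exact Nat.findGreatest_spec (P := fun i => κ i < κ (i + 1) + γ (i + 1)) (m := j)
        (by have := hlt γ hm j hj; omega) hj
    · intro i' hi'
      by_contra hc
      push Not at hc
      exact Nat.findGreatest_is_greatest hi' (by have := hlt γ hm i' hc; omega) hc
  choose! p hp1 hp2 using hex
  have hBm : ∀ γ ∈ B, γ ∈ Finset.piAntidiag (Finset.range l) r := fun γ h =>
    (Finset.mem_filter.1 h).1
  have hp0 : ∀ γ ∈ B, p γ + 1 < l := fun γ h => hlt γ (hBm γ h) _ (hp1 γ h)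
  have e1 : ∀ γ i, pieriFlip κ γ i i = κ (i + 1) + γ (i + 1) - 1 - κ i := by
    intro γ i; simp [pieriFlip]
  have e2 : ∀ γ i, pieriFlip κ γ i (i + 1) = κ i + γ i + 1 - κ (i + 1) := by
    intro γ i; simp [pieriFlip]
  have e3 : ∀ γ i j, j ≠ i → j ≠ i + 1 → pieriFlip κ γ i j = γ j := by
    intro γ i j h1 h2; simp [pieriFlip, h1, h2]
  have hstep : ∀ i, κ (i + 1) ≤ κ i := fun i => hκ (Nat.le_succ i)
  have hmem : ∀ γ ∈ B, pieriFlip κ γ (p γ) ∈ B := by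
    intro γ h
    have hm := hBm γ h
    have h1 := hp1 γ h
    have h0 := hp0 γ h
    have hs := hstep (p γ)
    rw [hB, Finset.mem_filter]
    refine ⟨?_, ?_⟩
    · rw [Finset.mem_piAntidiag] at hm ⊢
      refine ⟨?_, ?_⟩
      · rw [← hm.1]
        have hsub : ({p γ, p γ + 1} : Finset ℕ) ⊆ Finset.range l := by
          intro x hx
          simp only [Finset.mem_insert, Finset.mem_singleton] at hx
          simp only [Finset.mem_range]; omega
        rw [← Finset.sum_sdiff hsub, ← Finset.sum_sdiff hsub (f := γ)]
        congr 1
        · refine Finset.sum_congr rfl fun j hj => ?_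
          simp only [Finset.mem_sdiff, Finset.mem_insert, Finset.mem_singleton, not_or] at hj
          exact e3 _ _ _ hj.2.1 hj.2.2
        · rw [Finset.sum_pair (by omega), Finset.sum_pair (by omega), e1, e2]
          omega
      · intro j hj
        by_contra hc
        simp only [Finset.mem_range] at hc
        rw [e3 _ _ _ (by omega) (by omega)] at hj
        exact hj (hzero γ (hBm γ h) j (by omega))
    · push Not
      refine ⟨p γ, ?_⟩
      rw [e2]; omega
  have hpp : ∀ γ ∈ B, p (pieriFlip κ γ (p γ)) = p γ := by
    intro γ h
    have h1 := hp1 γ h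
    have hs := hstep (p γ)
    have g1 := hp1 _ (hmem γ h)
    rcases lt_trichotomy (p (pieriFlip κ γ (p γ))) (p γ) with hl | hl | hl
    · have g2 := hp2 _ (hmem γ h) _ hl
      rw [e2] at g2; omega
    · exact hl
    · have g2 := hp2 γ h _ hl
      rw [e3 _ _ _ (by omega) (by omega)] at g1
      omega
  have hanti : ∀ γ ∈ B, alt l (κ + pieriFlip κ γ (p γ)) = - alt l (κ + γ) := by
    intro γ h
    have h1 := hp1 γ h
    have hs := hstep (p γ)
    apply alt_swap (hp0 γ h)
    · simp only [Pi.add_apply, e1]; omega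
    · simp only [Pi.add_apply, e2]; omega
    · intro j ha hb
      simp only [Pi.add_apply, e3 _ _ _ ha hb]
  refine Finset.sum_involution (fun γ _ => pieriFlip κ γ (p γ)) ?_ ?_ hmem ?_
  · intro γ h
    rw [hanti γ h]; ring
  · intro γ h hne heq
    have := hanti γ h
    rw [heq] at this
    exact hne (self_eq_neg.1 this)
  · intro γ h
    simp only [hpp γ h]
    have h1 := hp1 γ h
    have hs := hstep (p γ)
    funext j
    by_cases hj : j = p γ
    · rw [hj, e1, e2]; omega
    by_cases hj' : j = p γ + 1
    · rw [hj', e2, e1]; omega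
    rw [e3 _ _ _ hj hj', e3 _ _ _ hj hj']

/-- All chains of strips starting at `mu` with step sizes `β`, of length `n`. -/
noncomputable def chainsRec (l : ℕ) (mu β : ℕ → ℕ) : ℕ → Finset (ℕ → ℕ → ℕ)
  | 0 => {fun _ => mu}
  | n + 1 => (chainsRec l mu β n).biUnion fun C =>
      (stripSet l (C n) (β n)).image fun γ j => if j ≤ n then C j else C n + γ

lemma mem_chainsRec (l : ℕ) (mu β : ℕ → ℕ) (hz : ∀ i, l ≤ i → mu i = 0) (n : ℕ) :
    ∀ C, C ∈ chainsRec l mu β n ↔ C 0 = mu ∧ (∀ j, n ≤ j → C j = C n) ∧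
      (∀ j i, C j i ≤ C (j + 1) i) ∧ (∀ j < n, ∀ i, C (j + 1) (i + 1) ≤ C j i) ∧
      (∀ j < n, ∑ r ∈ Finset.range l, C (j + 1) r = ∑ r ∈ Finset.range l, C j r + β j) ∧
      ∀ j i, l ≤ i → C j i = 0 := by
  induction n with
  | zero =>
    intro C
    simp only [chainsRec, Finset.mem_singleton]
    constructor
    · rintro rfl
      simp
      exact hz
    · rintro ⟨h1, h2, -⟩
      funext j
      rw [h2 j (by omega), h1]
  | succ n ih =>
    intro C
    simp only [chainsRec, Finset.mem_biUnion, Finset.mem_image]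
    constructor
    · rintro ⟨D, hD, γ, hγ, rfl⟩
      rw [ih] at hD
      obtain ⟨h1, h2, h3, h4, h5, h6⟩ := hD
      rw [stripSet, Finset.mem_filter, Finset.mem_piAntidiag] at hγ
      obtain ⟨⟨g1, g2⟩, g3⟩ := hγ
      refine ⟨by simpa using h1, ?_, ?_, ?_, ?_, ?_⟩
      · intro j hj
        simp only
        rw [if_neg (by omega), if_neg (by omega)]
      · intro j i
        simp only
        rcases lt_trichotomy j n with hj | hj | hj
        · rw [if_pos (by omega), if_pos (by omega)]; exact h3 j i
        · subst hj
          simp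
        · rw [if_neg (by omega), if_neg (by omega)]
      · intro j hj i
        simp only
        by_cases hj' : j = n
        · subst hj'
          simpa using g3 i
        · rw [if_pos (by omega), if_pos (by omega)]; exact h4 j (by omega) i
      · intro j hj
        simp only
        by_cases hj' : j = n
        · subst hj'
          simp [Finset.sum_add_distrib, g1]
        · rw [if_pos (by omega), if_pos (by omega)]; exact h5 j (by omega)
      · intro j i hi
        simp only
        split_ifs
        · exact h6 j i hi
        · rw [Pi.add_apply, h6 n i hi]
          by_contra hc
          have := g2 i (by omega)
          simp at this; omega
    · rintro ⟨h1, h2, h3, h4, h5, h6⟩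
      refine ⟨fun j => if j ≤ n then C j else C n, ?_, fun i => C (n + 1) i - C n i, ?_, ?_⟩
      · rw [ih]
        refine ⟨by simpa using h1, ?_, ?_, ?_, ?_, ?_⟩
        · intro j hj
          simp only [le_refl, if_true]
          split_ifs with h
          · rw [le_antisymm h hj]
          · rfl
        · intro j i
          by_cases hj : j < n
          · rw [if_pos (by omega), if_pos (by omega)]; exact h3 j i
          · rw [if_neg (by omega : ¬ j + 1 ≤ n)]
            split_ifs with h
            · rw [show j = n by omega]
            · rfl
        · intro j hj i
          rw [if_pos (by omega), if_pos (by omega)]; exact h4 j (by omega) i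
        · intro j hj
          rw [if_pos (by omega), if_pos (by omega)]; exact h5 j (by omega)
        · intro j i hi
          split_ifs
          · exact h6 j i hi
          · exact h6 n i hi
      · rw [stripSet, Finset.mem_filter, Finset.mem_piAntidiag]
        simp only [le_refl, if_true]
        refine ⟨⟨?_, ?_⟩, ?_⟩
        · have := h5 n (by omega)
          have e : ∑ r ∈ Finset.range l, C n r + ∑ r ∈ Finset.range l, (C (n + 1) r - C n r) =
              ∑ r ∈ Finset.range l, C (n + 1) r := by
            rw [← Finset.sum_add_distrib]
            refine Finset.sum_congr rfl fun r _ => ?_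
            have := h3 n r; omega
          omega
        · intro i hi
          simp only [Finset.mem_range]
          by_contra hc
          rw [h6 (n + 1) i (by omega)] at hi
          omega
        · intro i
          have := h3 n (i + 1)
          have := h4 n (by omega) i
          omega
      · funext j i
        simp only [le_refl, if_true]
        by_cases hj : j ≤ n
        · simp [hj]
        · rw [if_neg hj, h2 j (by omega)]
          have := h3 n i
          simp only [Pi.add_apply]
          omega

lemma alt_mul_prod (l : ℕ) (mu β : ℕ → ℕ) (hmu : Antitone mu) (hz : ∀ i, l ≤ i → mu i = 0)
    (n : ℕ) : alt l mu * ∏ j ∈ Finset.range n, hPoly l (β j) =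
      ∑ C ∈ chainsRec l mu β n, alt l (C n) := by
  induction n with
  | zero => simp [chainsRec]
  | succ n ih =>
    rw [Finset.prod_range_succ, ← mul_assoc, ih, chainsRec, Finset.sum_biUnion, Finset.sum_mul]
    · refine Finset.sum_congr rfl fun C hC => ?_
      rw [mem_chainsRec l mu β hz] at hC
      obtain ⟨h1, h2, h3, h4, h5, h6⟩ := hC
      have hanti : Antitone (C n) := by
        apply antitone_nat_of_succ_le
        intro i
        rcases n with _ | n
        · rw [h1]; exact hmu (Nat.le_succ i)
        · exact (h4 n (by omega) i).trans (h3 n i)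
      rw [pieri l (C n) hanti (h6 n), Finset.sum_image]
      · refine Finset.sum_congr rfl fun γ _ => ?_
        simp
      · intro γ _ γ' _ h
        have := congrFun h (n + 1)
        simpa using this
    · intro C hC D hD hne
      rw [Function.onFun, Finset.disjoint_left]
      intro E hE hE'
      simp only [Finset.mem_image] at hE hE'
      obtain ⟨γ, -, rfl⟩ := hE
      obtain ⟨γ', -, h⟩ := hE'
      rw [Finset.mem_coe, mem_chainsRec l mu β hz] at hC hD
      apply hne
      have hle : ∀ j, j ≤ n → C j = D j := by
        intro j hj
        have := congrFun h j
        simp only [hj, if_true] at this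
        exact this.symm
      funext j
      by_cases hj : j ≤ n
      · exact hle j hj
      · rw [hC.2.1 j (by omega), hD.2.1 j (by omega), hle n le_rfl]

/-- Exponent vectors as finitely supported functions. -/
noncomputable def fe {l : ℕ} (f : Fin l → ℕ) : Fin l →₀ ℕ := Finsupp.equivFunOnFinite.symm f

lemma fe_apply {l : ℕ} (f : Fin l → ℕ) (i : Fin l) : fe f i = f i := rfl

lemma fe_inj {l : ℕ} {f g : Fin l → ℕ} : fe f = fe g ↔ f = g :=
  Finsupp.equivFunOnFinite.symm.injective.eq_iff

/-- Shifted exponent vector `v + δ`. -/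
def shiftVec (l : ℕ) (v : ℕ → ℕ) : Fin l → ℕ := fun i => v i + (l - 1 - i)

lemma prod_eq_monomial {l : ℕ} (σ : Equiv.Perm (Fin l)) (f : Fin l → ℕ) :
    ∏ i, (MvPolynomial.X (σ i) : MvPolynomial (Fin l) ℤ) ^ f i =
      MvPolynomial.monomial (fe (f ∘ σ.symm)) 1 := by
  rw [MvPolynomial.monomial_eq, Finsupp.prod_fintype _ _ (by simp), map_one, one_mul,
    ← Equiv.prod_comp σ (fun i => (MvPolynomial.X i : MvPolynomial (Fin l) ℤ) ^
      (fe (f ∘ σ.symm)) i)]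
  simp [fe_apply]

lemma alt_eq_sum (l : ℕ) (v : ℕ → ℕ) : alt l v = ∑ σ : Equiv.Perm (Fin l),
    ((Equiv.Perm.sign σ : ℤ) : MvPolynomial (Fin l) ℤ) *
      MvPolynomial.monomial (fe (shiftVec l v ∘ σ.symm)) 1 := by
  unfold alt
  rw [Matrix.det_apply']
  refine Finset.sum_congr rfl fun σ _ => ?_
  rw [← prod_eq_monomial]
  rfl

lemma coeff_int_mul {l : ℕ} (e : Fin l →₀ ℕ) (c : ℤ) (F : MvPolynomial (Fin l) ℤ) :
    MvPolynomial.coeff e ((c : MvPolynomial (Fin l) ℤ) * F) = c * MvPolynomial.coeff e F := by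
  rw [← MvPolynomial.coeff_C_mul]
  simp

lemma coeff_alt (l : ℕ) (u v : ℕ → ℕ) : MvPolynomial.coeff (fe (shiftVec l u)) (alt l v) =
    ∑ σ : Equiv.Perm (Fin l), (Equiv.Perm.sign σ : ℤ) *
      if shiftVec l v = shiftVec l u ∘ σ then 1 else 0 := by
  rw [alt_eq_sum, MvPolynomial.coeff_sum]
  refine Finset.sum_congr rfl fun σ _ => ?_
  rw [coeff_int_mul, MvPolynomial.coeff_monomial]
  congr 2
  rw [fe_inj, Equiv.comp_symm_eq]

lemma shiftVec_strictAnti {l : ℕ} {v : ℕ → ℕ} (hv : Antitone v) : StrictAnti (shiftVec l v) := by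
  intro i j hij
  have h1 : v j ≤ v i := hv (le_of_lt hij)
  have h2 : (i : ℕ) < j := hij
  have := j.2
  simp only [shiftVec]
  omega

lemma perm_eq_one {l : ℕ} {f g : Fin l → ℕ} (hf : StrictAnti f) (hg : StrictAnti g)
    {σ : Equiv.Perm (Fin l)} (h : f = g ∘ σ) : σ = 1 := by
  have hm : StrictMono σ := by
    intro i j hij
    have := hf hij
    rw [h] at this
    exact hg.lt_iff_gt.1 this
  have : (σ : Fin l → Fin l) = id := by
    apply (StrictMono.range_inj hm strictMono_id).1
    rw [σ.range_eq_univ, Set.range_id]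
  ext i
  rw [this]; rfl

lemma shiftVec_eq_iff {l : ℕ} {u v : ℕ → ℕ} : shiftVec l u = shiftVec l v ↔ ∀ i < l, u i = v i := by
  constructor
  · intro h i hi
    have := congrFun h ⟨i, hi⟩
    simp only [shiftVec] at this
    omega
  · intro h
    funext i
    simp [shiftVec, h i i.2]

lemma coeff_alt_anti {l : ℕ} {u v : ℕ → ℕ} (hu : Antitone u) (hv : Antitone v) :
    MvPolynomial.coeff (fe (shiftVec l u)) (alt l v) = if ∀ i < l, v i = u i then 1 else 0 := by
  rw [coeff_alt, Finset.sum_eq_single 1]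
  · simp [← shiftVec_eq_iff]
  · intro σ _ hσ
    rw [if_neg, mul_zero]
    intro h
    exact hσ (perm_eq_one (shiftVec_strictAnti hv) (shiftVec_strictAnti hu) h)
  · simp

/-- `h_{n-d}` or zero. -/
noncomputable def hShift (l n d : ℕ) : MvPolynomial (Fin l) ℤ := if d ≤ n then hPoly l (n - d) else 0

/-- Jacobi-Trudi determinant. -/
noncomputable def schurJT (l : ℕ) (a : ℕ → ℕ) : MvPolynomial (Fin l) ℤ :=
  ∑ w : Equiv.Perm (Fin l), ((Equiv.Perm.sign w : ℤ) : MvPolynomial (Fin l) ℤ) *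
    ∏ j : Fin l, hShift l (shiftVec l a (w j)) (l - 1 - j)

lemma rename_schurJT (l : ℕ) (a : ℕ → ℕ) (σ : Equiv.Perm (Fin l)) :
    MvPolynomial.rename σ (schurJT l a) = schurJT l a := by
  have h : ∀ n d, MvPolynomial.rename σ (hShift l n d) = hShift l n d := by
    intro n d
    unfold hShift
    split_ifs
    · exact rename_hPoly l _ σ
    · simp
  simp [schurJT, h]

lemma coeff_one_perm (l : ℕ) (mu lam : ℕ → ℕ) (hmu : Antitone mu) (hlam : Antitone lam)
    (hz : ∀ i, l ≤ i → mu i = 0) (hl : ∀ i, l ≤ i → lam i = 0) (m : Fin l → ℕ) :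
    MvPolynomial.coeff (fe (shiftVec l lam))
      (alt l mu * ∏ j : Fin l, hShift l (m j) (l - 1 - j)) =
    ∑ C ∈ chainSet l mu lam hl, if shiftVec l (stepSize l C) = m then 1 else 0 := by
  by_cases hd : ∀ j : Fin l, l - 1 - j ≤ m j
  · set β : ℕ → ℕ := fun j => if h : j < l then m ⟨j, h⟩ - (l - 1 - j) else 0 with hβ
    have e1 : ∏ j : Fin l, hShift l (m j) (l - 1 - j) = ∏ j ∈ Finset.range l, hPoly l (β j) := by
      rw [Finset.prod_range]
      refine Finset.prod_congr rfl fun j _ => ?_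
      simp [hShift, hd j, hβ]
    rw [e1, alt_mul_prod l mu β hmu hz, MvPolynomial.coeff_sum]
    have e2 : ∀ C ∈ chainsRec l mu β l,
        MvPolynomial.coeff (fe (shiftVec l lam)) (alt l (C l)) = if C l = lam then 1 else 0 := by
      intro C hC
      rw [mem_chainsRec l mu β hz] at hC
      obtain ⟨h1, h2, h3, h4, h5, h6⟩ := hC
      have hanti : Antitone (C l) := by
        apply antitone_nat_of_succ_le
        intro i
        rcases Nat.eq_zero_or_pos l with h0 | h0
        · rw [h6 l (i + 1) (by omega)]; omega
        · have a := h4 (l - 1) (by omega) i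
          have b := h3 (l - 1) i
          rw [Nat.sub_add_cancel h0] at a b
          exact a.trans b
      rw [coeff_alt_anti hlam hanti]
      congr 1
      apply propext
      constructor
      · intro h
        funext i
        by_cases hi : i < l
        · exact h i hi
        · rw [h6 l i (by omega), hl i (by omega)]
      · intro h i _
        rw [h]
    rw [Finset.sum_congr rfl e2, ← Finset.sum_filter, ← Finset.sum_filter]
    refine Finset.sum_congr ?_ fun _ _ => rfl
    ext C
    rw [Finset.mem_filter, Finset.mem_filter, mem_chainsRec l mu β hz, mem_chainSet]
    constructor
    · rintro ⟨⟨h1, h2, h3, h4, h5, h6⟩, h7⟩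
      refine ⟨⟨h1, fun j hj => by rw [h2 j hj, h7], h3, ?_⟩, ?_⟩
      · intro j i
        by_cases hj : j < l
        · exact h4 j hj i
        · rw [h2 j (by omega), h2 (j + 1) (by omega), h7]
          exact hlam (Nat.le_succ i)
      · funext j
        have a := h5 j j.2
        have b := hd j
        simp only [hβ, j.2, dif_pos, Fin.eta] at a
        simp only [shiftVec, stepSize]
        omega
    · rintro ⟨hC, hs⟩
      refine ⟨⟨hC.1, ?_, hC.2.2.1, fun j _ i => hC.2.2.2 j i, ?_, chain_zero hC hl⟩,
        hC.2.1 l le_rfl⟩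
      · intro j hj
        rw [hC.2.1 j hj, hC.2.1 l le_rfl]
      · intro j hj
        have a := congrFun hs ⟨j, hj⟩
        have b := sum_mono_chain hC l j
        simp only [shiftVec, stepSize] at a
        simp only [hβ, hj, dif_pos]
        omega
  · push Not at hd
    obtain ⟨j, hj⟩ := hd
    rw [Finset.prod_eq_zero (Finset.mem_univ j), mul_zero, MvPolynomial.coeff_zero]
    · symm
      apply Finset.sum_eq_zero
      intro C _
      rw [if_neg]
      intro h
      rw [← h] at hj
      simp only [shiftVec] at hj
      omega
    · rw [hShift, if_neg (by omega)]

lemma coeff_alt_mul_schur (l : ℕ) (mu lam a : ℕ → ℕ) (hmu : Antitone mu) (hlam : Antitone lam)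
    (hz : ∀ i, l ≤ i → mu i = 0) (hl : ∀ i, l ≤ i → lam i = 0) :
    MvPolynomial.coeff (fe (shiftVec l lam)) (alt l mu * schurJT l a) =
    ∑ C ∈ chainSet l mu lam hl, MvPolynomial.coeff (fe (shiftVec l a)) (alt l (stepSize l C)) := by
  simp only [coeff_alt]
  rw [Finset.sum_comm, schurJT, Finset.mul_sum, MvPolynomial.coeff_sum]
  refine Finset.sum_congr rfl fun w _ => ?_
  rw [mul_left_comm, coeff_int_mul, coeff_one_perm l mu lam hmu hlam hz hl, Finset.mul_sum]
  rfl

/-- Set of LR chains. -/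
noncomputable def lrChains (l : ℕ) (mu lam a : ℕ → ℕ) (hl : ∀ i, l ≤ i → lam i = 0) :
    Finset (ℕ → ℕ → ℕ) :=
  (chainSet l mu lam hl).filter fun C => LatticeChain C ∧ ∀ j < l, stepSize l C j = a j

lemma lattice_size_anti {l : ℕ} {mu lam : ℕ → ℕ} {C : ℕ → ℕ → ℕ} (hC : IsStripChain l mu lam C)
    (hl : ∀ i, l ≤ i → lam i = 0) (hL : LatticeChain C) : Antitone (stepSize l C) := by
  apply antitone_nat_of_succ_le
  intro j
  have h := hL j l
  unfold Viol at h
  simp only [Finset.sum_range_succ, chain_zero hC hl _ l le_rfl] at h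
  have h1 := sum_mono_chain hC l j
  have h2 := sum_mono_chain hC l (j + 1)
  unfold stepSize
  change ∑ r ∈ Finset.range l, C (j + 2) r - _ ≤ _
  omega

theorem coeff_eq_card (l : ℕ) (mu lam a : ℕ → ℕ) (hmu : Antitone mu) (hlam : Antitone lam)
    (ha : Antitone a) (hz : ∀ i, l ≤ i → mu i = 0) (hl : ∀ i, l ≤ i → lam i = 0) :
    MvPolynomial.coeff (fe (shiftVec l lam)) (alt l mu * schurJT l a) =
      ((lrChains l mu lam a hl).card : ℤ) := by
  rw [coeff_alt_mul_schur l mu lam a hmu hlam hz hl]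
  rw [sum_chains_eq l mu lam hl (fun b => MvPolynomial.coeff (fe (shiftVec l a)) (alt l b))]
  · rw [lrChains, ← Finset.filter_filter, Finset.card_filter]
    push_cast
    refine Finset.sum_congr rfl fun C hC => ?_
    rw [Finset.mem_filter, mem_chainSet] at hC
    rw [coeff_alt_anti ha (lattice_size_anti hC.1 hl hC.2)]
  · intro k hk b b' h1 h2 h3
    simp only
    rw [alt_swap hk h1 h2 h3, MvPolynomial.coeff_neg]

/-- Antisymmetric polynomials. -/
def Antisymm {l : ℕ} (F : MvPolynomial (Fin l) ℤ) : Prop := ∀ σ : Equiv.Perm (Fin l),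
  MvPolynomial.rename σ F = ((Equiv.Perm.sign σ : ℤ) : MvPolynomial (Fin l) ℤ) * F

lemma sign_sq {l : ℕ} (σ : Equiv.Perm (Fin l)) :
    (Equiv.Perm.sign σ : ℤ) * (Equiv.Perm.sign σ : ℤ) = 1 := by
  rcases Int.units_eq_one_or (Equiv.Perm.sign σ) with h | h <;> simp [h]

lemma Antisymm.coeff {l : ℕ} {F : MvPolynomial (Fin l) ℤ} (hF : Antisymm F) (f : Fin l → ℕ)
    (σ : Equiv.Perm (Fin l)) : MvPolynomial.coeff (fe (f ∘ σ)) F =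
      (Equiv.Perm.sign σ : ℤ) * MvPolynomial.coeff (fe f) F := by
  have h := MvPolynomial.coeff_rename_mapDomain (σ : Fin l → Fin l) σ.injective F (fe (f ∘ σ))
  have e : Finsupp.mapDomain σ (fe (f ∘ σ)) = fe f := by
    ext i
    rw [Finsupp.mapDomain_equiv_apply]
    simp [fe_apply]
  rw [hF σ, coeff_int_mul, e] at h
  exact h.symm

lemma antisymm_mul (l : ℕ) (mu a : ℕ → ℕ) : Antisymm (alt l mu * schurJT l a) := by
  intro σ
  rw [map_mul, rename_alt, rename_schurJT, mul_assoc]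

lemma Antisymm.eq_zero {l : ℕ} {F : MvPolynomial (Fin l) ℤ} (hF : Antisymm F)
    (h : ∀ lam : ℕ → ℕ, Antitone lam → (∀ i, l ≤ i → lam i = 0) →
      MvPolynomial.coeff (fe (shiftVec l lam)) F = 0) : F = 0 := by
  ext e
  rw [MvPolynomial.coeff_zero]
  obtain ⟨f, rfl⟩ : ∃ f : Fin l → ℕ, fe f = e := ⟨e, by ext; rfl⟩
  by_cases hinj : Function.Injective f
  · set σ : Equiv.Perm (Fin l) := Fin.revPerm.trans (Tuple.sort f) with hσ
    have hsm : StrictMono (f ∘ Tuple.sort f) :=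
      (Tuple.monotone_sort f).strictMono_of_injective (hinj.comp (Tuple.sort f).injective)
    have hsa : StrictAnti (f ∘ σ) := by
      intro i j hij
      exact hsm (Fin.rev_lt_rev.2 hij)
    set u := f ∘ σ with hu
    have hlow : ∀ d, ∀ i : Fin l, l - 1 - (i : ℕ) = d → d ≤ u i := by
      intro d
      induction d with
      | zero => intro i _; omega
      | succ d ih =>
        intro i hi
        have h1 := ih ⟨i + 1, by omega⟩ (by simp only; omega)
        have h2 : u ⟨i + 1, by omega⟩ < u i := hsa (by rw [Fin.lt_def]; simp)
        omega
    set lam : ℕ → ℕ := fun i => if hi : i < l then u ⟨i, hi⟩ - (l - 1 - i) else 0 with hlam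
    have hsh : shiftVec l lam = u := by
      funext i
      have := hlow _ i rfl
      simp only [shiftVec, hlam, i.2, dif_pos, Fin.eta]
      omega
    have hanti : Antitone lam := by
      apply antitone_nat_of_succ_le
      intro i
      by_cases hi : i + 1 < l
      · have h2 : u ⟨i + 1, hi⟩ < u ⟨i, by omega⟩ := hsa (by rw [Fin.lt_def]; simp)
        simp only [hlam, hi, dif_pos, (by omega : i < l)]
        omega
      · simp only [hlam, hi, dif_neg, not_false_eq_true]
        omega
    have h0 := h lam hanti (by intro i hi; simp [hlam, Nat.not_lt.2 hi])
    rw [hsh, hu, hF.coeff] at h0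
    have := sign_sq σ
    rcases mul_eq_zero.1 h0 with h1 | h1
    · rw [h1] at this; omega
    · exact h1
  · simp only [Function.Injective, not_forall] at hinj
    obtain ⟨a, b, hab, hne⟩ := hinj
    have h1 := hF.coeff f (Equiv.swap a b)
    have e : f ∘ Equiv.swap a b = f := by
      funext i
      simp only [Function.comp]
      by_cases ha : i = a
      · rw [ha, Equiv.swap_apply_left, hab]
      by_cases hb : i = b
      · rw [hb, Equiv.swap_apply_right, hab]
      rw [Equiv.swap_apply_of_ne_of_ne ha hb]
    rw [e, Equiv.Perm.sign_swap hne] at h1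
    simp at h1
    omega

/-- The superstandard chain. -/
def superChain (lam : ℕ → ℕ) : ℕ → ℕ → ℕ := fun j i => if i < j then lam i else 0

lemma super_sum (lam : ℕ → ℕ) (n j : ℕ) : ∑ r ∈ Finset.range n, superChain lam (j + 1) r =
    ∑ r ∈ Finset.range n, superChain lam j r + if j < n then lam j else 0 := by
  induction n with
  | zero => simp
  | succ n ih =>
    rw [Finset.sum_range_succ, Finset.sum_range_succ, ih]
    simp only [superChain]
    rcases lt_trichotomy j n with h | h | h
    · simp [h, show ¬ n < j + 1 by omega, show ¬ n < j by omega, show j < n + 1 by omega]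
    · subst h; simp
    · simp [show n < j + 1 by omega, h, show ¬ j < n + 1 by omega, show ¬ j < n by omega]

lemma super_mem (l : ℕ) (lam : ℕ → ℕ) (hlam : Antitone lam) (hl : ∀ i, l ≤ i → lam i = 0) :
    IsStripChain l 0 lam (superChain lam) ∧ LatticeChain (superChain lam) ∧
      ∀ j < l, stepSize l (superChain lam) j = lam j := by
  refine ⟨⟨?_, ?_, ?_, ?_⟩, ?_, ?_⟩
  · funext i; simp [superChain]
  · intro j hj
    funext i
    simp only [superChain]
    split_ifs
    · rfl
    · rw [hl i (by omega)]
  · intro j i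
    simp only [superChain]
    split_ifs <;> omega
  · intro j i
    have := hlam (Nat.le_succ i)
    simp only [superChain]
    split_ifs <;> omega
  · intro j i h
    unfold Viol at h
    rw [super_sum lam (i + 1) (j + 1), super_sum lam i j] at h
    have := hlam (Nat.le_succ j)
    simp only [Nat.succ_eq_add_one] at this
    split_ifs at h <;> omega
  · intro j hj
    rw [stepSize, super_sum, if_pos hj]
    omega

lemma super_unique {l : ℕ} {lam : ℕ → ℕ} {C : ℕ → ℕ → ℕ} (hC : IsStripChain l 0 lam C)
    (hL : LatticeChain C) : C = superChain lam := by
  have h0 : ∀ j i, j ≤ i → C j i = 0 := by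
    intro j
    induction j with
    | zero => intro i _; rw [hC.1]; rfl
    | succ j ih =>
      intro i hi
      obtain ⟨i, rfl⟩ : ∃ i', i = i' + 1 := ⟨i - 1, by omega⟩
      have := hC.2.2.2 j i
      rw [ih i (by omega)] at this
      omega
  have h1 : ∀ j i, i ≤ j → ∑ r ∈ Finset.range i, C (j + 1) r = ∑ r ∈ Finset.range i, C j r := by
    intro j
    induction j with
    | zero => intro i hi; simp [Nat.le_zero.1 hi]
    | succ j ih =>
      intro i hi
      rcases i with _ | i
      · simp
      have a := hL j i
      unfold Viol at a
      rw [ih i (by omega)] at a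
      have b := sum_mono_chain hC (i + 1) (j + 1)
      change _ ≤ ∑ r ∈ Finset.range (i + 1), C (j + 2) r at b
      change ∑ r ∈ Finset.range (i + 1), C (j + 2) r = _
      omega
  have h2 : ∀ j i, i < j → C (j + 1) i = C j i := by
    intro j i hi
    have a := h1 j i (by omega)
    have b := h1 j (i + 1) (by omega)
    rw [Finset.sum_range_succ, Finset.sum_range_succ] at b
    omega
  have h3 : ∀ i n, C (i + 1 + n) i = C (i + 1) i := by
    intro i n
    induction n with
    | zero => rfl
    | succ n ih => rw [← ih]; exact h2 (i + 1 + n) i (by omega)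
  funext j i
  simp only [superChain]
  split_ifs with h
  · have a := h3 i (j - (i + 1))
    have b := h3 i l
    rw [show i + 1 + (j - (i + 1)) = j by omega] at a
    rw [hC.2.1 (i + 1 + l) (by omega)] at b
    rw [a, b]
  · exact h0 j i (by omega)

theorem jacobi_trudi (l : ℕ) (a : ℕ → ℕ) (ha : Antitone a) :
    alt l 0 * schurJT l a = alt l a := by
  rw [← sub_eq_zero]
  apply Antisymm.eq_zero
  · intro σ
    rw [map_sub, antisymm_mul, rename_alt, mul_sub]
  · intro lam hlam hl
    rw [MvPolynomial.coeff_sub, coeff_eq_card l 0 lam a (fun _ _ _ => le_rfl) hlam ha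
      (fun _ _ => rfl) hl, coeff_alt_anti hlam ha, sub_eq_zero]
    obtain ⟨s1, s2, s3⟩ := super_mem l lam hlam hl
    split_ifs with h
    · have : lrChains l 0 lam a hl = {superChain lam} := by
        ext C
        rw [lrChains, Finset.mem_filter, mem_chainSet, Finset.mem_singleton]
        constructor
        · rintro ⟨h1, h2, -⟩
          exact super_unique h1 h2
        · rintro rfl
          exact ⟨s1, s2, fun j hj => by rw [s3 j hj, h j hj]⟩
      rw [this]; simp
    · have : lrChains l 0 lam a hl = ∅ := by
        rw [lrChains, Finset.filter_eq_empty_iff]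
        rintro C hC ⟨hL, hs⟩
        rw [mem_chainSet] at hC
        rw [super_unique hC hL] at hs
        apply h
        intro i hi
        rw [← hs i hi, s3 i hi]
      rw [this]; simp

lemma pairing {l k : ℕ} {F : MvPolynomial (Fin l) ℤ} (hF : Antisymm F) (b lam : ℕ → ℕ)
    (hb : ∀ i < l, b i + lam (l - 1 - i) = k) :
    MvPolynomial.coeff (fe fun _ : Fin l => k + l - 1) (F * alt l b) =
      (l.factorial : ℤ) * ((Equiv.Perm.sign (Fin.revPerm : Equiv.Perm (Fin l)) : ℤ) *
        MvPolynomial.coeff (fe (shiftVec l lam)) F) := by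
  rw [alt_eq_sum, Finset.mul_sum, MvPolynomial.coeff_sum]
  have key : ∀ σ : Equiv.Perm (Fin l), MvPolynomial.coeff (fe fun _ : Fin l => k + l - 1)
      (F * (((Equiv.Perm.sign σ : ℤ) : MvPolynomial (Fin l) ℤ) *
        MvPolynomial.monomial (fe (shiftVec l b ∘ σ.symm)) 1)) =
      (Equiv.Perm.sign (Fin.revPerm : Equiv.Perm (Fin l)) : ℤ) *
        MvPolynomial.coeff (fe (shiftVec l lam)) F := by
    intro σ
    rw [mul_left_comm, coeff_int_mul, MvPolynomial.coeff_mul_monomial', if_pos, mul_one]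
    · have e : (fe fun _ : Fin l => k + l - 1) - fe (shiftVec l b ∘ σ.symm) =
          fe ((shiftVec l lam ∘ (Fin.revPerm : Equiv.Perm (Fin l))) ∘ σ.symm) := by
        ext i
        rw [Finsupp.tsub_apply]
        simp only [fe_apply, Function.comp, shiftVec, Fin.revPerm_apply, Fin.val_rev]
        have h1 := hb (σ.symm i) (σ.symm i).2
        have h2 := (σ.symm i).2
        rw [show l - (((σ.symm i : Fin l) : ℕ) + 1) = l - 1 - ((σ.symm i : Fin l) : ℕ) by omega]
        omega
      rw [e, hF.coeff, hF.coeff, Equiv.Perm.sign_symm, ← mul_assoc, sign_sq, one_mul]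
    · intro i
      simp only [fe_apply, Function.comp, shiftVec]
      have h1 := hb (σ.symm i) (σ.symm i).2
      have h2 := (σ.symm i).2
      omega
  rw [Finset.sum_congr rfl fun σ _ => key σ, Finset.sum_const, Finset.card_univ,
    Fintype.card_perm, Fintype.card_fin, nsmul_eq_mul]

theorem card_symm (l k : ℕ) (mu lam a lamc ac : ℕ → ℕ) (hmu : Antitone mu) (hlam : Antitone lam)
    (ha : Antitone a) (hlamc : Antitone lamc) (hac : Antitone ac)
    (hz : ∀ i, l ≤ i → mu i = 0) (hl : ∀ i, l ≤ i → lam i = 0) (hl' : ∀ i, l ≤ i → ac i = 0)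
    (h1 : ∀ i < l, lamc i + lam (l - 1 - i) = k) (h2 : ∀ i < l, a i + ac (l - 1 - i) = k) :
    (lrChains l mu lam a hl).card = (lrChains l mu ac lamc hl').card := by
  have e1 := pairing (antisymm_mul l mu a) lamc lam h1
  have e2 := pairing (antisymm_mul l mu lamc) a ac h2
  rw [coeff_eq_card l mu lam a hmu hlam ha hz hl] at e1
  rw [coeff_eq_card l mu ac lamc hmu hac hlamc hz hl'] at e2
  have e3 : alt l mu * schurJT l a * alt l lamc = alt l mu * schurJT l lamc * alt l a := by
    rw [← jacobi_trudi l lamc hlamc, ← jacobi_trudi l a ha]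
    ring
  rw [e3, e2] at e1
  have f0 : (l.factorial : ℤ) ≠ 0 := by exact_mod_cast l.factorial_ne_zero
  have s0 := sign_sq (Fin.revPerm : Equiv.Perm (Fin l))
  have s1 : (Equiv.Perm.sign (Fin.revPerm : Equiv.Perm (Fin l)) : ℤ) ≠ 0 := by
    intro h; rw [h] at s0; omega
  have := mul_left_cancel₀ s1 (mul_left_cancel₀ f0 e1)
  exact_mod_cast this.symm

lemma card_rows (S : Finset (ℕ × ℕ)) (n : ℕ) (a b : ℕ → ℕ)
    (h : ∀ r c, (r, c) ∈ S ↔ r < n ∧ a r ≤ c ∧ c < b r) :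
    S.card = ∑ r ∈ Finset.range n, (b r - a r) := by
  have h1 : S.card = ((Finset.range n).sigma fun r => Finset.Ico (a r) (b r)).card := by
    refine Finset.card_bij' (fun p _ => ⟨p.1, p.2⟩) (fun q _ => (q.1, q.2)) ?_ ?_ ?_ ?_
    · rintro ⟨r, c⟩ hp
      simpa using (h r c).1 hp
    · rintro ⟨r, c⟩ hp
      exact (h r c).2 (by simpa using hp)
    · intros; rfl
    · intros; rfl
  rw [h1, Finset.card_sigma]
  simp

lemma mem_skew {lam mu : YoungDiagram} {r c : ℕ} :
    (r, c) ∈ skewCells lam mu ↔ mu.rowLen r ≤ c ∧ c < lam.rowLen r := by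
  simp only [skewCells, Finset.mem_sdiff, YoungDiagram.mem_cells, YoungDiagram.mem_iff_lt_rowLen]
  omega

/-- A filling and a chain correspond to each other. -/
structure Match (lam mu : YoungDiagram) (T : ℕ × ℕ → ℕ) (C : ℕ → ℕ → ℕ) : Prop where
  key : ∀ i c, mu.rowLen i ≤ c → c < lam.rowLen i → ∀ j, (c < C j i ↔ T (i, c) ≤ j)
  lo : ∀ j i, mu.rowLen i ≤ C j i
  hi : ∀ j i, C j i ≤ lam.rowLen i
  supp : ∀ p, p ∈ skewCells lam mu ↔ T p ≠ 0

namespace Match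

variable {lam mu : YoungDiagram} {T T' : ℕ × ℕ → ℕ} {C C' : ℕ → ℕ → ℕ}

lemma chain_unique (h : Match lam mu T C) (h' : Match lam mu T C') : C = C' := by
  have aux : ∀ {D D' : ℕ → ℕ → ℕ}, Match lam mu T D → Match lam mu T D' → ∀ j i,
      D j i ≤ D' j i := by
    intro D D' h h' j i
    by_contra hlt
    have h1 := h.key i (D' j i) (h'.lo j i) (by have := h.hi j i; omega) j
    have h2 := h'.key i (D' j i) (h'.lo j i) (by have := h.hi j i; omega) j
    omega
  funext j i
  exact le_antisymm (aux h h' j i) (aux h' h j i)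

lemma filling_unique (h : Match lam mu T C) (h' : Match lam mu T' C) : T = T' := by
  funext p
  obtain ⟨i, c⟩ := p
  by_cases hp : (i, c) ∈ skewCells lam mu
  · have hm := mem_skew.1 hp
    have h1 := h.key i c hm.1 hm.2
    have h2 := h'.key i c hm.1 hm.2
    have := (h1 (T' (i, c))).symm.trans (h2 (T' (i, c)))
    have := (h1 (T (i, c))).symm.trans (h2 (T (i, c)))
    omega
  · have h1 : T (i, c) = 0 := by by_contra h0; exact hp ((h.supp _).2 h0)
    have h2 : T' (i, c) = 0 := by by_contra h0; exact hp ((h'.supp _).2 h0)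
    rw [h1, h2]

lemma mono (h : Match lam mu T C) (j i : ℕ) : C j i ≤ C (j + 1) i := by
  by_contra hlt
  have h1 := h.key i (C (j + 1) i) (h.lo _ i) (by have := h.hi j i; omega)
  have := h1 j
  have := h1 (j + 1)
  omega

lemma start (h : Match lam mu T C) : C 0 = mu.rowLen := by
  funext i
  by_contra hne
  have h0 := h.lo 0 i
  have h2 := h.hi 0 i
  have h1 := (h.key i (mu.rowLen i) le_rfl (by omega) 0).1 (by omega)
  have := (h.supp (i, mu.rowLen i)).1 (mem_skew.2 ⟨le_rfl, by omega⟩)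
  omega

lemma value (h : Match lam mu T C) (k i c : ℕ) :
    ((i, c) ∈ skewCells lam mu ∧ T (i, c) = k + 1) ↔ (C k i ≤ c ∧ c < C (k + 1) i) := by
  have hl := h.lo k i
  have hh := h.hi (k + 1) i
  rw [mem_skew]
  constructor
  · rintro ⟨⟨h1, h2⟩, h3⟩
    have a := h.key i c h1 h2 k
    have b := h.key i c h1 h2 (k + 1)
    omega
  · rintro ⟨h1, h2⟩
    have a := h.key i c (by omega) (by omega) k
    have b := h.key i c (by omega) (by omega) (k + 1)
    omega

lemma row_mono (h : Match lam mu T C) (i j1 j2 : ℕ) (h1 : (i, j1) ∈ skewCells lam mu)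
    (h2 : (i, j2) ∈ skewCells lam mu) (hj : j1 ≤ j2) : T (i, j1) ≤ T (i, j2) := by
  rw [mem_skew] at h1 h2
  have a := h.key i j1 h1.1 h1.2 (T (i, j2))
  have b := h.key i j2 h2.1 h2.2 (T (i, j2))
  omega

lemma content_eq (h : Match lam mu T C) {l : ℕ} (hl : ∀ i, l ≤ i → lam.rowLen i = 0) (k : ℕ) :
    content lam mu T (k + 1) = stepSize l C k := by
  have : content lam mu T (k + 1) = ∑ r ∈ Finset.range l, (C (k + 1) r - C k r) := by
    unfold content
    apply card_rows
    intro r c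
    rw [Finset.mem_filter, h.value]
    constructor
    · intro h1
      refine ⟨?_, h1⟩
      by_contra hr
      have := hl r (by omega)
      have := h.hi (k + 1) r
      omega
    · exact fun h1 => h1.2
  rw [this, Finset.sum_tsub_distrib _ (fun r _ => h.mono k r)]
  rfl

lemma readCount_eq (h : Match lam mu T C) (i j k : ℕ) :
    prefixCount lam mu T i j (k + 1) + ∑ r ∈ Finset.range i, C k r =
      ∑ r ∈ Finset.range i, C (k + 1) r + (C (k + 1) i - max j (C k i)) := by
  have : prefixCount lam mu T i j (k + 1) = ∑ r ∈ Finset.range (i + 1),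
      (C (k + 1) r - (if r < i then C k r else max j (C k r))) := by
    unfold prefixCount
    apply card_rows
    intro r c
    have hv := h.value k r c
    rw [Finset.mem_filter]
    dsimp only
    rw [show ((r, c) ∈ skewCells lam mu ∧ (r < i ∨ r = i ∧ j ≤ c) ∧ T (r, c) = k + 1) ↔
      ((r < i ∨ r = i ∧ j ≤ c) ∧ ((r, c) ∈ skewCells lam mu ∧ T (r, c) = k + 1)) by tauto, hv]
    split_ifs <;> omega
  rw [this, Finset.sum_range_succ]
  have h2 : ∑ r ∈ Finset.range i, (C (k + 1) r - (if r < i then C k r else max j (C k r))) =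
      ∑ r ∈ Finset.range i, (C (k + 1) r - C k r) := by
    refine Finset.sum_congr rfl fun r hr => ?_
    rw [if_pos (Finset.mem_range.1 hr)]
  rw [h2, Finset.sum_tsub_distrib _ (fun r _ => h.mono k r)]
  have h3 : ∑ r ∈ Finset.range i, C k r ≤ ∑ r ∈ Finset.range i, C (k + 1) r :=
    Finset.sum_le_sum fun r _ => h.mono k r
  simp only [lt_irrefl, if_false]
  omega

lemma lattice_iff (h : Match lam mu T C) : IsLattice lam mu T ↔ LatticeChain C := by
  constructor
  · intro hL k i hV
    have h0 := hL i (C (k + 1) i) k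
    have h1 := h.readCount_eq i (C (k + 1) i) k
    have h2 := h.readCount_eq i (C (k + 1) i) (k + 1)
    have h3 := h.mono k i
    have h4 := h.mono (k + 1) i
    unfold Viol at hV
    rw [Finset.sum_range_succ, Finset.sum_range_succ] at hV
    rw [show k + 1 + 1 = k + 2 from rfl] at h2 h4
    rw [max_self] at h2
    rw [max_eq_left h3] at h1
    omega
  · intro hC i j k
    have h0 := hC k i
    have h1 := h.readCount_eq i j k
    have h2 := h.readCount_eq i j (k + 1)
    have h3 := h.mono k i
    have h4 := h.mono (k + 1) i
    unfold Viol at h0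
    rw [Finset.sum_range_succ, Finset.sum_range_succ] at h0
    rw [show k + 1 + 1 = k + 2 from rfl] at h2 h4
    omega

lemma col_iff (h : Match lam mu T C) :
    (∀ i1 i2 j, (i1, j) ∈ skewCells lam mu → (i2, j) ∈ skewCells lam mu → i1 < i2 →
      T (i1, j) < T (i2, j)) ↔ ∀ j i, C (j + 1) (i + 1) ≤ C j i := by
  constructor
  · intro hc j i
    by_contra hlt
    have a1 := h.lo j i
    have a2 := h.hi (j + 1) (i + 1)
    have a3 : mu.rowLen (i + 1) ≤ mu.rowLen i := mu.rowLen_anti _ _ (Nat.le_succ i)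
    have a4 : lam.rowLen (i + 1) ≤ lam.rowLen i := lam.rowLen_anti _ _ (Nat.le_succ i)
    have b1 := h.key i (C j i) a1 (by omega) j
    have b2 := h.key (i + 1) (C j i) (by omega) (by omega) (j + 1)
    have b3 := hc i (i + 1) (C j i) (mem_skew.2 (by omega)) (mem_skew.2 (by omega)) (by omega)
    omega
  · intro hs i1 i2 c h1 h2 hlt
    have ha : ∀ j, Antitone (C j) := fun j =>
      antitone_nat_of_succ_le fun i => le_trans (h.mono j (i + 1)) (hs j i)
    have hp := (h.supp _).1 h2
    rw [mem_skew] at h1 h2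
    obtain ⟨j, hj⟩ := Nat.exists_eq_succ_of_ne_zero hp
    have b2 := h.key i2 c h2.1 h2.2 (j + 1)
    have b1 := h.key i1 c h1.1 h1.2 j
    have b3 : C (j + 1) i2 ≤ C (j + 1) (i1 + 1) := ha (j + 1) hlt
    have b4 := hs j i1
    omega

lemma isLR_iff (h : Match lam mu T C) {alp : YoungDiagram} {l : ℕ}
    (hl : ∀ i, l ≤ i → lam.rowLen i = 0) (ha : ∀ i, l ≤ i → alp.rowLen i = 0) :
    IsLR lam mu alp T ↔ IsStripChain l mu.rowLen lam.rowLen C ∧ LatticeChain C ∧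
      ∀ j < l, stepSize l C j = alp.rowLen j := by
  constructor
  · rintro ⟨⟨_, _, hc⟩, hL, hct⟩
    refine ⟨⟨h.start, ?_, h.mono, h.col_iff.1 hc⟩, h.lattice_iff.1 hL, ?_⟩
    · intro j hj
      funext i
      by_contra hne
      have h1 := h.hi j i
      have h0 := h.lo j i
      have h2 := h.key i (C j i) h0 (by omega) j
      obtain ⟨t, ht⟩ : ∃ t, T (i, C j i) = t + 1 := ⟨T (i, C j i) - 1, by omega⟩
      have h3 := hct t
      rw [ha t (by omega)] at h3
      unfold content at h3
      rw [Finset.card_eq_zero] at h3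
      have : (i, C j i) ∈ (skewCells lam mu).filter fun p => T p = t + 1 :=
        Finset.mem_filter.2 ⟨mem_skew.2 (by omega), ht⟩
      rw [h3] at this
      simp at this
    · intro j _
      rw [← hct j, h.content_eq hl]
  · rintro ⟨⟨_, he, _, hs⟩, hL, hst⟩
    refine ⟨⟨h.supp, h.row_mono, h.col_iff.2 hs⟩, h.lattice_iff.2 hL, ?_⟩
    intro i
    rw [h.content_eq hl]
    by_cases hi : i < l
    · exact hst i hi
    · unfold stepSize
      rw [he i (by omega), he (i + 1) (by omega), ha i (by omega)]
      simp

end Match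

/-- The chain of a filling. -/
noncomputable def chainOf (lam mu : YoungDiagram) (T : ℕ × ℕ → ℕ) (j i : ℕ) : ℕ :=
  mu.rowLen i + ((Finset.Ico (mu.rowLen i) (lam.rowLen i)).filter fun c => T (i, c) ≤ j).card

/-- The filling of a chain. -/
noncomputable def fillOf (l : ℕ) (lam mu : YoungDiagram) (C : ℕ → ℕ → ℕ) (p : ℕ × ℕ) : ℕ :=
  if mu.rowLen p.1 ≤ p.2 ∧ p.2 < lam.rowLen p.1 then
    ((Finset.range l).filter fun j => C j p.1 ≤ p.2).card else 0

lemma rowLen_mono {lam mu : YoungDiagram} (h : mu ≤ lam) (i : ℕ) : mu.rowLen i ≤ lam.rowLen i := by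
  by_contra hlt
  have h1 : (i, lam.rowLen i) ∈ mu := YoungDiagram.mem_iff_lt_rowLen.2 (by omega)
  have h2 := YoungDiagram.mem_iff_lt_rowLen.1 (h h1)
  omega

lemma le_of_rowLen {lam mu : YoungDiagram} (h : ∀ i, mu.rowLen i ≤ lam.rowLen i) : mu ≤ lam := by
  rintro ⟨i, c⟩ hp
  have hp' := YoungDiagram.mem_iff_lt_rowLen.1 hp
  exact YoungDiagram.mem_iff_lt_rowLen.2 (lt_of_lt_of_le hp' (h i))

lemma match_chainOf {lam mu : YoungDiagram} {T : ℕ × ℕ → ℕ} (h : mu ≤ lam)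
    (hT : IsSSYT lam mu T) : Match lam mu T (chainOf lam mu T) := by
  refine ⟨?_, ?_, ?_, hT.1⟩
  · intro i c h1 h2 j
    unfold chainOf
    by_cases hc : T (i, c) ≤ j
    · have : Finset.Ico (mu.rowLen i) (c + 1) ⊆
          (Finset.Ico (mu.rowLen i) (lam.rowLen i)).filter fun c => T (i, c) ≤ j := by
        intro d hd
        rw [Finset.mem_Ico] at hd
        rw [Finset.mem_filter, Finset.mem_Ico]
        refine ⟨by omega, le_trans ?_ hc⟩
        exact hT.2.1 i d c (mem_skew.2 (by omega)) (mem_skew.2 (by omega)) (by omega)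
      have := Finset.card_le_card this
      rw [Nat.card_Ico] at this
      omega
    · have : (Finset.Ico (mu.rowLen i) (lam.rowLen i)).filter (fun c => T (i, c) ≤ j) ⊆
          Finset.Ico (mu.rowLen i) c := by
        intro d hd
        rw [Finset.mem_filter, Finset.mem_Ico] at hd
        rw [Finset.mem_Ico]
        refine ⟨hd.1.1, ?_⟩
        by_contra hdc
        have := hT.2.1 i c d (mem_skew.2 (by omega)) (mem_skew.2 (by omega)) (by omega)
        omega
      have := Finset.card_le_card this
      rw [Nat.card_Ico] at this
      omega
  · intro j i
    unfold chainOf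
    omega
  · intro j i
    unfold chainOf
    have h1 := Finset.card_filter_le (Finset.Ico (mu.rowLen i) (lam.rowLen i))
      (fun c => T (i, c) ≤ j)
    rw [Nat.card_Ico] at h1
    have := rowLen_mono h i
    omega

lemma chain_mono {l : ℕ} {m n : ℕ → ℕ} {C : ℕ → ℕ → ℕ} (hC : IsStripChain l m n C) (i : ℕ) :
    Monotone fun j => C j i := monotone_nat_of_le_succ fun j => hC.2.2.1 j i

lemma chain_lo {l : ℕ} {m n : ℕ → ℕ} {C : ℕ → ℕ → ℕ} (hC : IsStripChain l m n C) (j i : ℕ) :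
    m i ≤ C j i := by
  have h := chain_mono hC i (Nat.zero_le j)
  simp only [hC.1] at h
  exact h

lemma chain_hi {l : ℕ} {m n : ℕ → ℕ} {C : ℕ → ℕ → ℕ} (hC : IsStripChain l m n C) (j i : ℕ) :
    C j i ≤ n i := by
  have h := chain_mono hC i (le_max_left j l)
  simp only [hC.2.1 _ (le_max_right j l)] at h
  exact h

lemma match_fillOf {l : ℕ} {lam mu : YoungDiagram} {C : ℕ → ℕ → ℕ}
    (hC : IsStripChain l mu.rowLen lam.rowLen C) : Match lam mu (fillOf l lam mu C) C := by
  have key : ∀ i c, mu.rowLen i ≤ c → c < lam.rowLen i → ∀ j,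
      (c < C j i ↔ fillOf l lam mu C (i, c) ≤ j) := by
    intro i c h1 h2 j
    unfold fillOf
    dsimp only
    rw [if_pos ⟨h1, h2⟩]
    by_cases hj : c < C j i
    · simp only [hj, true_iff]
      have : (Finset.range l).filter (fun j => C j i ≤ c) ⊆ Finset.range j := by
        intro t ht
        rw [Finset.mem_filter] at ht
        rw [Finset.mem_range]
        by_contra hjt
        have : C j i ≤ C t i := chain_mono hC i (not_lt.1 hjt)
        omega
      have := Finset.card_le_card this
      rwa [Finset.card_range] at this
    · simp only [hj, false_iff, not_le]
      have hjl : j < l := by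
        by_contra hjl
        rw [hC.2.1 j (by omega)] at hj
        exact hj h2
      have : Finset.range (j + 1) ⊆ (Finset.range l).filter (fun j => C j i ≤ c) := by
        intro t ht
        rw [Finset.mem_range] at ht
        rw [Finset.mem_filter, Finset.mem_range]
        have : C t i ≤ C j i := chain_mono hC i (Nat.lt_succ_iff.1 ht)
        omega
      have := Finset.card_le_card this
      rwa [Finset.card_range] at this
  refine ⟨key, chain_lo hC, chain_hi hC, ?_⟩
  rintro ⟨i, c⟩
  rw [mem_skew]
  constructor
  · intro h h0
    have := key i c h.1 h.2 0
    rw [hC.1] at this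
    omega
  · intro h
    by_contra hn
    exact h (if_neg hn)

lemma lrCoeff_eq_card {l : ℕ} (lam mu alp : YoungDiagram)
    (hl : ∀ i, l ≤ i → lam.rowLen i = 0) (ha : ∀ i, l ≤ i → alp.rowLen i = 0) :
    lrCoeff lam mu alp = (lrChains l mu.rowLen lam.rowLen alp.rowLen hl).card := by
  have hmem : ∀ C, C ∈ lrChains l mu.rowLen lam.rowLen alp.rowLen hl ↔
      IsStripChain l mu.rowLen lam.rowLen C ∧ LatticeChain C ∧
        ∀ j < l, stepSize l C j = alp.rowLen j := by
    intro C
    unfold lrChains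
    rw [Finset.mem_filter, mem_chainSet]
  unfold lrCoeff
  split_ifs with hm
  · rw [← Set.ncard_coe_finset]
    refine Set.ncard_congr (fun T _ => chainOf lam mu T) ?_ ?_ ?_
    · intro T hT
      exact Finset.mem_coe.2 ((hmem _).2 (((match_chainOf hm hT.1).isLR_iff hl ha).1 hT))
    · intro T T' hT hT' heq
      have h1 := match_chainOf hm hT.1
      have h2 := match_chainOf hm hT'.1
      rw [heq] at h1
      exact h1.filling_unique h2
    · intro C hC
      have hC' := (hmem C).1 (Finset.mem_coe.1 hC)
      have h1 := match_fillOf hC'.1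
      have h2 := (h1.isLR_iff hl ha).2 hC'
      exact ⟨fillOf l lam mu C, h2, (match_chainOf hm h2.1).chain_unique h1⟩
  · symm
    rw [Finset.card_eq_zero, Finset.eq_empty_iff_forall_notMem]
    intro C hC
    have hC' := ((hmem C).1 hC).1
    exact hm (le_of_rowLen fun i => le_trans (chain_lo hC' 0 i) (chain_hi hC' 0 i))

lemma mem_rect {k l i c : ℕ} : (i, c) ∈ rect k l ↔ i < l ∧ c < k := by
  rw [← YoungDiagram.mem_cells]
  simp [rect]

lemma mem_complRect {k l i c : ℕ} {nu : YoungDiagram} :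
    (i, c) ∈ complRect k l nu ↔ (i < l ∧ c < k) ∧ (l - 1 - i, k - 1 - c) ∉ nu := by
  rw [← mem_rect, ← YoungDiagram.mem_cells]
  simp [complRect]

lemma rowLen_le_of_rect {k l : ℕ} {nu : YoungDiagram} (h : nu ≤ rect k l) (i : ℕ) :
    nu.rowLen i ≤ k := by
  by_contra hlt
  have h1 := mem_rect.1 (h (YoungDiagram.mem_iff_lt_rowLen.2 (not_le.1 hlt) : (i, k) ∈ nu))
  omega

lemma rowLen_zero_of_rect {k l : ℕ} {nu : YoungDiagram} (h : nu ≤ rect k l) (i : ℕ) (hi : l ≤ i) :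
    nu.rowLen i = 0 := by
  by_contra hlt
  have h1 := mem_rect.1 (h (YoungDiagram.mem_iff_lt_rowLen.2 (Nat.pos_of_ne_zero hlt) :
    (i, 0) ∈ nu))
  omega

lemma complRect_le (k l : ℕ) (nu : YoungDiagram) : complRect k l nu ≤ rect k l := by
  rintro ⟨i, c⟩ hp
  have hp' : (i, c) ∈ complRect k l nu := hp
  exact mem_rect.2 (mem_complRect.1 hp').1

lemma rowLen_complRect {k l : ℕ} {nu : YoungDiagram} (h : nu ≤ rect k l) (i : ℕ) (hi : i < l) :
    (complRect k l nu).rowLen i + nu.rowLen (l - 1 - i) = k := by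
  have hk := rowLen_le_of_rect h (l - 1 - i)
  have hk' := rowLen_le_of_rect (complRect_le k l nu) i
  have key : ∀ c, c < (complRect k l nu).rowLen i ↔
      (i < l ∧ c < k) ∧ ¬ (k - 1 - c < nu.rowLen (l - 1 - i)) := by
    intro c
    rw [← YoungDiagram.mem_iff_lt_rowLen, ← YoungDiagram.mem_iff_lt_rowLen, mem_complRect]
  have h1 := key ((complRect k l nu).rowLen i)
  have h2 := key ((complRect k l nu).rowLen i - 1)
  omega

/-- duality between skew Schur expansions and the `(k^l)`-truncated (Schubert)
product: the coefficient of `s_alp` in `s_{lam/mu}` equals the coefficient of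
`s_{alp^{-1}}` in `[mu] ⋆_{(k^l)} [lam^{-1}]`. -/
theorem lrCoeff_complement_duality (k l : ℕ) (lam mu alp : YoungDiagram)
    (hmu : mu ≤ lam) (hlam : lam ≤ rect k l) (halp : alp ≤ rect k l) :
    lrCoeff lam mu alp = lrCoeff (complRect k l alp) mu (complRect k l lam) := by
  have hz := rowLen_zero_of_rect (hmu.trans hlam)
  have hl := rowLen_zero_of_rect hlam
  have ha := rowLen_zero_of_rect halp
  have hlc := rowLen_zero_of_rect (complRect_le k l lam)
  have hac := rowLen_zero_of_rect (complRect_le k l alp)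
  rw [lrCoeff_eq_card lam mu alp hl ha, lrCoeff_eq_card (complRect k l alp) mu _ hac hlc]
  refine card_symm l k mu.rowLen lam.rowLen alp.rowLen (complRect k l lam).rowLen
    (complRect k l alp).rowLen (fun _ _ h => mu.rowLen_anti _ _ h) (fun _ _ h => lam.rowLen_anti _ _ h)
    (fun _ _ h => alp.rowLen_anti _ _ h) (fun _ _ h => (complRect k l lam).rowLen_anti _ _ h)
    (fun _ _ h => (complRect k l alp).rowLen_anti _ _ h) hz hl hac (rowLen_complRect hlam) ?_
  intro i hi
  have := rowLen_complRect halp (l - 1 - i) (by omega)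
  rw [show l - 1 - (l - 1 - i) = i by omega] at this
  omega

end LRSkew
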